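/- arXiv:2111.03257 — 10 statements merged into one kernel-verified Lean document; each statement's English description precedes it below -/
import Mathlib

section
/- For any two integer partitions p and p', the ℓ1 distance between the partitions equals the ℓ1 distance between their cumulative prevalence vectors: ∑_{i≥1} |p_i − p'_i| = ∑_{r≥1} |φ_{≥r}(p) − φ_{≥r}(p')| (all differences and absolute values taken in ℤ). -/
/-- An integer partition: a nonincreasing sequence `p : ℕ → ℕ` with finite support.
(We index from 0; `p i` is the `(i+1)`-st part.) -/
def IsPartition (p : ℕ → ℕ) : Prop :=
  Antitone p ∧ (Function.support p).Finite

/-- The ℓ1 distance `‖p − q‖₁ = ∑_{i} |p_i − q_i|` (differences taken in ℤ). -/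
noncomputable def l1 (p q : ℕ → ℕ) : ℕ :=
  ∑ᶠ i : ℕ, ((p i : ℤ) - (q i : ℤ)).natAbs

/-- The cumulative prevalence `φ_{≥ r}(p) = |{i : p_i ≥ r}|`. -/
noncomputable def phi (p : ℕ → ℕ) (r : ℕ) : ℕ :=
  Set.ncard {i : ℕ | r ≤ p i}

theorem natAbs_eq_sum_xor (a b M : ℕ) (ha : a ≤ M) (hb : b ≤ M) :
    ((a : ℤ) - (b : ℤ)).natAbs
      = ∑ r ∈ Finset.range M, if (r < a ↔ r < b) then 0 else 1 := by
  have h1 : (∑ r ∈ Finset.range M, if (r < a ↔ r < b) then 0 else 1)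
      = (Finset.Ico (min a b) (max a b)).card := by
    have h2 : ∀ r, (if (r < a ↔ r < b) then 0 else 1) = if ¬ (r < a ↔ r < b) then 1 else 0 := by
      intro r
      rw [ite_not]
    rw [Finset.sum_congr rfl (fun r _ => h2 r), ← Finset.card_filter]
    congr 1
    ext r
    simp only [Finset.mem_filter, Finset.mem_range, Finset.mem_Ico]
    omega
  rw [h1, Nat.card_Ico]
  omega

theorem lt_phi_iff (p : ℕ → ℕ) (hp : IsPartition p) (i r : ℕ) :
    i < phi p (r + 1) ↔ r < p i := by
  obtain ⟨ha, hf⟩ := hp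
  have hfin : {i : ℕ | r + 1 ≤ p i}.Finite := by
    apply hf.subset
    intro j hj
    simp only [Set.mem_setOf_eq, Function.mem_support] at *
    omega
  unfold phi
  constructor
  · intro h
    by_contra hc
    have hsub : {i : ℕ | r + 1 ≤ p i} ⊆ Set.Iio i := by
      intro j hj
      simp only [Set.mem_setOf_eq, Set.mem_Iio] at *
      by_contra hji
      have := ha (not_lt.mp hji)
      omega
    have := Set.ncard_le_ncard hsub (Set.finite_Iio i)
    have h3 : (Set.Iio i).ncard = i := by
      rw [Set.ncard_eq_toFinset_card']; simp
    omega
  · intro h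
    have hsub : Set.Iic i ⊆ {i : ℕ | r + 1 ≤ p i} := by
      intro j hj
      have := ha (Set.mem_Iic.mp hj)
      simp only [Set.mem_setOf_eq]
      omega
    have h2 := Set.ncard_le_ncard hsub hfin
    have h3 : (Set.Iic i).ncard = i + 1 := by
      rw [Set.ncard_eq_toFinset_card']; simp
    omega

theorem exists_bound (p : ℕ → ℕ) (hp : IsPartition p) : ∃ N, ∀ i, N ≤ i → p i = 0 := by
  obtain ⟨N, hN⟩ := hp.2.bddAbove
  refine ⟨N + 1, fun i hi => ?_⟩
  by_contra h
  have := hN (Function.mem_support.mpr h)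
  omega

/-- For any two integer partitions `p` and `q`,
`∑_{i ≥ 1} |p_i − q_i| = ∑_{r ≥ 1} |φ_{≥ r}(p) − φ_{≥ r}(q)|`. -/
theorem l1_eq_l1_of_cumulative_prevalences
    (p q : ℕ → ℕ) (hp : IsPartition p) (hq : IsPartition q) :
    l1 p q = ∑ᶠ r : ℕ, ((phi p (r + 1) : ℤ) - (phi q (r + 1) : ℤ)).natAbs := by
  obtain ⟨N1, h1⟩ := exists_bound p hp
  obtain ⟨N2, h2⟩ := exists_bound q hq
  set N := max N1 N2 with hN
  set R := max (p 0) (q 0) with hR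
  have hpR : ∀ i, p i ≤ R := fun i => (hp.1 (Nat.zero_le i)).trans (le_max_left _ _)
  have hqR : ∀ i, q i ≤ R := fun i => (hq.1 (Nat.zero_le i)).trans (le_max_right _ _)
  have hpN : ∀ r, phi p (r + 1) ≤ N := fun r => by
    by_contra h
    have := (lt_phi_iff p hp N r).1 (not_le.mp h)
    have := h1 N (le_max_left _ _)
    omega
  have hqN : ∀ r, phi q (r + 1) ≤ N := fun r => by
    by_contra h
    have := (lt_phi_iff q hq N r).1 (not_le.mp h)
    have := h2 N (le_max_right _ _)
    omega
  unfold l1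
  rw [finsum_eq_sum_of_support_subset (s := Finset.range N),
    finsum_eq_sum_of_support_subset (s := Finset.range R)]
  · rw [Finset.sum_congr rfl (fun i _ => natAbs_eq_sum_xor (p i) (q i) R (hpR i) (hqR i)),
      Finset.sum_congr rfl (fun r _ => natAbs_eq_sum_xor _ _ N (hpN r) (hqN r)),
      Finset.sum_comm]
    simp only [lt_phi_iff p hp, lt_phi_iff q hq]
  · intro r hr
    rw [Finset.coe_range, Set.mem_Iio]
    by_contra hc
    apply hr
    have e1 : phi p (r + 1) = 0 := by
      by_contra h
      have := (lt_phi_iff p hp 0 r).1 (Nat.pos_of_ne_zero h)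
      have := hpR 0
      omega
    have e2 : phi q (r + 1) = 0 := by
      by_contra h
      have := (lt_phi_iff q hq 0 r).1 (Nat.pos_of_ne_zero h)
      have := hqR 0
      omega
    simp [e1, e2]
  · intro i hi
    rw [Finset.coe_range, Set.mem_Iio]
    by_contra hc
    apply hi
    have e1 := h1 i (by omega)
    have e2 := h2 i (by omega)
    simp [e1, e2]
end

section
/- For any integer partitions p¹, p², q¹, q² it holds that ‖(p¹ ∪ p²) − (q¹ ∪ q²)‖₁ ≤ ‖p¹ − q¹‖₁ + ‖p² − q²‖₁. -/
/-- The union `p ∪ q` of two integer partitions: the combined multiset of all nonzero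
entries of `p` and of `q`, listed in nonincreasing order, followed by zeros. -/
noncomputable def unionSeq (p q : ℕ → ℕ)
    (hp : (Function.support p).Finite) (hq : (Function.support q).Finite) : ℕ → ℕ :=
  fun i => ((hp.toFinset.val.map p + hq.toFinset.val.map q).sort (· ≥ ·)).getD i 0

lemma sum_abs_same_sign (s : Finset ℕ) (f g : ℕ → ℤ)
    (h : (∀ i, f i ≤ g i) ∨ (∀ i, g i ≤ f i)) :
    ∑ i ∈ s, |f i - g i| = |∑ i ∈ s, f i - ∑ i ∈ s, g i| := by
  rw [← Finset.sum_sub_distrib]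
  rcases h with h | h
  · rw [abs_of_nonpos (Finset.sum_nonpos fun i _ => sub_nonpos.2 (h i)), ← Finset.sum_neg_distrib]
    exact Finset.sum_congr rfl fun i _ => abs_of_nonpos (sub_nonpos.2 (h i))
  · rw [abs_of_nonneg (Finset.sum_nonneg fun i _ => sub_nonneg.2 (h i))]
    exact Finset.sum_congr rfl fun i _ => abs_of_nonneg (sub_nonneg.2 (h i))

/-- Indicator of `t < a`. -/
def ind (t a : ℕ) : ℤ := if t < a then 1 else 0

lemma ind_mono (t : ℕ) {a b : ℕ} (h : a ≤ b) : ind t a ≤ ind t b := by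
  unfold ind; split_ifs <;> omega

lemma sum_ind (T a : ℕ) (h : a ≤ T) : ∑ t ∈ Finset.range T, ind t a = a := by
  induction T generalizing a with
  | zero => simp; omega
  | succ T ih =>
    rw [Finset.sum_range_succ]
    rcases Nat.lt_or_ge T a with h1 | h1
    · have : a = T + 1 := by omega
      subst this
      have : ∑ t ∈ Finset.range T, ind t (T+1) = ∑ t ∈ Finset.range T, ind t T := by
        apply Finset.sum_congr rfl
        intro t ht
        have := Finset.mem_range.1 ht
        unfold ind; split_ifs <;> omega
      rw [this, ih T le_rfl]
      simp [ind]
    · rw [ih a h1]; simp [ind]; omega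

/-- Number of entries exceeding `t` among the first `M`. -/
def cnt (p : ℕ → ℕ) (M t : ℕ) : ℤ := ∑ i ∈ Finset.range M, ind t (p i)

lemma l1_eq (p q : ℕ → ℕ) (hp : Antitone p) (hq : Antitone q) (M T : ℕ)
    (hpM : ∀ i, M ≤ i → p i = 0) (hqM : ∀ i, M ≤ i → q i = 0)
    (hpT : ∀ i, p i ≤ T) (hqT : ∀ i, q i ≤ T) :
    (l1 p q : ℤ) = ∑ t ∈ Finset.range T, |cnt p M t - cnt q M t| := by
  have h1 : l1 p q = ∑ i ∈ Finset.range M, ((p i : ℤ) - (q i : ℤ)).natAbs := by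
    apply finsum_eq_sum_of_support_subset
    intro i hi
    by_contra hc
    have : M ≤ i := by simpa using hc
    simp [hpM i this, hqM i this] at hi
  have h2 : ∀ i, |(p i : ℤ) - q i| = ∑ t ∈ Finset.range T, |ind t (p i) - ind t (q i)| := by
    intro i
    rw [sum_abs_same_sign, sum_ind _ _ (hpT i), sum_ind _ _ (hqT i)]
    rcases le_total (p i) (q i) with h | h
    · exact Or.inl fun t => ind_mono t h
    · exact Or.inr fun t => ind_mono t h
  rw [h1]
  push_cast
  rw [Finset.sum_congr rfl fun i _ => h2 i, Finset.sum_comm]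
  apply Finset.sum_congr rfl
  intro t _
  apply sum_abs_same_sign
  by_contra! hc
  obtain ⟨⟨i, hi⟩, ⟨j, hj⟩⟩ := hc
  have a1 : q i ≤ t ∧ t < p i := by
    unfold ind at hi; split_ifs at hi <;> omega
  have a2 : p j ≤ t ∧ t < q j := by
    unfold ind at hj; split_ifs at hj <;> omega
  rcases le_total i j with h | h
  · have := hq h; omega
  · have := hp h; omega

lemma cnt_list (L : List ℕ) (M t : ℕ) (h : L.length ≤ M) :
    cnt (fun i => L.getD i 0) M t = (L.map (ind t)).sum := by
  unfold cnt
  induction L generalizing M with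
  | nil => simp [ind]
  | cons a L ih =>
    obtain ⟨M, rfl⟩ : ∃ k, M = k + 1 := ⟨M - 1, by simp at h; omega⟩
    rw [Finset.sum_range_succ']
    have := ih M (by simpa using h)
    simp only [List.getD_cons_succ, List.getD_cons_zero, List.map_cons, List.sum_cons]
    rw [this, add_comm]

lemma supp_sum (p : ℕ → ℕ) (hp : (Function.support p).Finite) (M t : ℕ)
    (hM : ∀ i, M ≤ i → p i = 0) :
    ((hp.toFinset.val.map p).map (ind t)).sum = cnt p M t := by
  rw [Multiset.map_map]
  change ∑ i ∈ hp.toFinset, ind t (p i) = _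
  apply Finset.sum_subset
  · intro i hi
    by_contra hc
    have : M ≤ i := by simpa using hc
    simp [hM i this] at hi
  · intro i _ hi
    have : p i = 0 := by simpa using hi
    simp [this, ind]

lemma union_facts (p q : ℕ → ℕ) (hp : (Function.support p).Finite)
    (hq : (Function.support q).Finite) :
    ∃ K, ∀ M, K ≤ M → Antitone (unionSeq p q hp hq) ∧ (∀ i, M ≤ i → unionSeq p q hp hq i = 0) ∧
      (∀ i, M ≤ i → p i = 0) ∧ (∀ i, M ≤ i → q i = 0) ∧
      ∀ t, cnt (unionSeq p q hp hq) M t = cnt p M t + cnt q M t := by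
  set S := hp.toFinset.val.map p + hq.toFinset.val.map q with hS
  set L := S.sort (· ≥ ·) with hL
  have hU : unionSeq p q hp hq = fun i => L.getD i 0 := rfl
  obtain ⟨A, hA⟩ := hp.bddAbove
  obtain ⟨B, hB⟩ := hq.bddAbove
  refine ⟨L.length + (A + 1) + (B + 1), fun M hM => ?_⟩
  have hpM : ∀ i, M ≤ i → p i = 0 := by
    intro i hi
    by_contra hc
    have := hA (show i ∈ Function.support p from hc)
    omega
  have hqM : ∀ i, M ≤ i → q i = 0 := by
    intro i hi
    by_contra hc
    have := hB (show i ∈ Function.support q from hc)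
    omega
  refine ⟨?_, ?_, hpM, hqM, ?_⟩
  · rw [hU]
    intro i j hij
    show L.getD j 0 ≤ L.getD i 0
    rcases Nat.lt_or_ge j L.length with hj | hj
    · have hs : L.Pairwise (· ≥ ·) := Multiset.pairwise_sort _ _
      rw [List.getD_eq_getElem _ _ hj, List.getD_eq_getElem _ _ (lt_of_le_of_lt hij hj)]
      rcases hij.eq_or_lt with rfl | h
      · exact le_rfl
      · exact List.pairwise_iff_getElem.1 hs i j _ _ h
    · rw [List.getD_eq_default _ _ hj]; exact Nat.zero_le _
  · intro i hi
    rw [hU]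
    exact List.getD_eq_default _ _ (by omega)
  · intro t
    rw [hU, cnt_list L M t (by omega), ← supp_sum p hp M t hpM, ← supp_sum q hq M t hqM,
      ← Multiset.sum_add, ← Multiset.map_add, ← hS, ← Multiset.sum_coe, ← Multiset.map_coe, hL,
      Multiset.sort_eq]

/-- `‖(p¹ ∪ p²) − (q¹ ∪ q²)‖₁ ≤ ‖p¹ − q¹‖₁ + ‖p² − q²‖₁`. -/
theorem l1_union_le (p1 p2 q1 q2 : ℕ → ℕ)
    (hp1 : IsPartition p1) (hp2 : IsPartition p2)
    (hq1 : IsPartition q1) (hq2 : IsPartition q2) :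
    l1 (unionSeq p1 p2 hp1.2 hp2.2) (unionSeq q1 q2 hq1.2 hq2.2) ≤
      l1 p1 q1 + l1 p2 q2 := by
  obtain ⟨K, hK⟩ := union_facts p1 p2 hp1.2 hp2.2
  obtain ⟨K', hK'⟩ := union_facts q1 q2 hq1.2 hq2.2
  obtain ⟨a1, a2, a3, a4, a5⟩ := hK (K + K') (by omega)
  obtain ⟨b1, b2, b3, b4, b5⟩ := hK' (K + K') (by omega)
  set u := unionSeq p1 p2 hp1.2 hp2.2
  set v := unionSeq q1 q2 hq1.2 hq2.2
  obtain ⟨T, hT⟩ : ∃ T, T = u 0 + v 0 + p1 0 + p2 0 + q1 0 + q2 0 := ⟨_, rfl⟩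
  have key : ∀ f : ℕ → ℕ, Antitone f → f 0 ≤ T → ∀ i, f i ≤ T :=
    fun f hf h i => (hf (Nat.zero_le i)).trans h
  zify
  rw [l1_eq u v a1 b1 (K + K') T a2 b2 (key _ a1 (by omega)) (key _ b1 (by omega)),
    l1_eq p1 q1 hp1.1 hq1.1 (K + K') T a3 b3 (key _ hp1.1 (by omega)) (key _ hq1.1 (by omega)),
    l1_eq p2 q2 hp2.1 hq2.1 (K + K') T a4 b4 (key _ hp2.1 (by omega)) (key _ hq2.1 (by omega)),
    ← Finset.sum_add_distrib]
  apply Finset.sum_le_sum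
  intro t _
  rw [a5, b5, add_sub_add_comm]
  exact abs_add_le _ _
end

section
/- Fix m ≥ 1. For any two integer partitions p and p', writing T_m p for the shifted tail sequence (p_{m+1}, p_{m+2}, …), one has ∑_{i=1}^{m} |p_i − p'_i| + ∑_{r=1}^{m} |φ_{≥r}(T_m p) − φ_{≥r}(T_m p')| ≤ ‖p − p'‖₁. In particular, the map sending p to the pair ((p_1,…,p_m), (φ_{≥1}(T_m p),…,φ_{≥m}(T_m p))) has ℓ1-sensitivity at most 1 with respect to the ℓ1 distance on integer partitions. -/
/-- The shifted tail sequence `T_m p = (p_{m+1}, p_{m+2}, …)`. -/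
def tailSeq (m : ℕ) (p : ℕ → ℕ) : ℕ → ℕ := fun i => p (i + m)

theorem aux_phi (q : ℕ → ℕ) (N r : ℕ) (h : ∀ i, N ≤ i → q i = 0) :
    (phi q (r + 1) : ℤ) = ∑ j ∈ Finset.range N, (if r + 1 ≤ q j then (1 : ℤ) else 0) := by
  have e : {i : ℕ | r + 1 ≤ q i} = ((Finset.range N).filter (fun j => r + 1 ≤ q j) : Finset ℕ) := by
    ext i
    simp only [Set.mem_ofPred_eq, Finset.coe_filter, Finset.mem_range]
    constructor
    · intro hi
      refine ⟨?_, hi⟩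
      by_contra hc
      have := h i (by omega)
      omega
    · exact fun hi => hi.2
  unfold phi
  rw [e, Set.ncard_coe_finset, Finset.card_filter]
  push_cast
  rfl

theorem aux_layer (a b m : ℕ) :
    ∑ r ∈ Finset.range m,
      |(if r + 1 ≤ a then (1 : ℤ) else 0) - (if r + 1 ≤ b then (1 : ℤ) else 0)| =
      |((min m a : ℕ) : ℤ) - ((min m b : ℕ) : ℤ)| := by
  induction m with
  | zero => simp
  | succ k ih =>
    rw [Finset.sum_range_succ, ih]
    split_ifs <;> simp only [abs_eq_max_neg] <;> omega

/-- For `m ≥ 1` and integer partitions `p, p'`: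
`∑_{i=1}^{m} |p_i − p'_i| + ∑_{r=1}^{m} |φ_{≥r}(T_m p) − φ_{≥r}(T_m p')| ≤ ‖p − p'‖₁`,
i.e. the map `p ↦ ((p_1,…,p_m), (φ_{≥1}(T_m p),…,φ_{≥m}(T_m p)))` has ℓ1-sensitivity
at most that of the identity. -/
theorem split_by_rank_sensitivity (m : ℕ) (hm : 1 ≤ m)
    (p p' : ℕ → ℕ) (hp : IsPartition p) (hp' : IsPartition p') :
    (∑ i ∈ Finset.range m, ((p i : ℤ) - (p' i : ℤ)).natAbs) +
      (∑ r ∈ Finset.range m,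
        ((phi (tailSeq m p) (r + 1) : ℤ) - (phi (tailSeq m p') (r + 1) : ℤ)).natAbs) ≤
      l1 p p' := by
  obtain ⟨N₁, h₁⟩ := hp.2.bddAbove
  obtain ⟨N₂, h₂⟩ := hp'.2.bddAbove
  obtain ⟨N, hN⟩ : ∃ N, N = N₁ + N₂ + 1 := ⟨_, rfl⟩
  have z : ∀ i, N ≤ i → p i = 0 := by
    intro i hi
    by_contra hc
    have : i ≤ N₁ := h₁ hc
    omega
  have z' : ∀ i, N ≤ i → p' i = 0 := by
    intro i hi
    by_contra hc
    have : i ≤ N₂ := h₂ hc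
    omega
  have hl : l1 p p' = ∑ i ∈ Finset.range (m + N), ((p i : ℤ) - (p' i : ℤ)).natAbs := by
    unfold l1
    apply finsum_eq_sum_of_support_subset
    intro i hi
    simp only [Finset.coe_range, Set.mem_Iio]
    by_contra hc
    apply hi
    simp [z i (by omega), z' i (by omega)]
  rw [hl, Finset.sum_range_add]
  apply Nat.add_le_add_left
  zify
  have e : ∀ r, (phi (tailSeq m p) (r + 1) : ℤ) - (phi (tailSeq m p') (r + 1) : ℤ) =
      ∑ j ∈ Finset.range N, ((if r + 1 ≤ p (m + j) then (1 : ℤ) else 0) -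
        (if r + 1 ≤ p' (m + j) then (1 : ℤ) else 0)) := by
    intro r
    rw [aux_phi (tailSeq m p) N r (fun i hi => z _ (by omega)),
      aux_phi (tailSeq m p') N r (fun i hi => z' _ (by omega)), Finset.sum_sub_distrib]
    simp only [tailSeq, Nat.add_comm m]
    rfl
  simp only [e]
  refine (Finset.sum_le_sum fun r _ => Finset.abs_sum_le_sum_abs _ _).trans ?_
  rw [Finset.sum_comm]
  refine Finset.sum_le_sum fun j _ => ?_
  rw [aux_layer]
  simp only [abs_eq_max_neg]
  omega
end

section
/- There is an absolute constant C > 0 such that for every real ε ≥ 1 and every n ∈ ℕ there exists a randomized algorithm A : I_{≤n} → PMF(I_{≤n}) which is ε-differentially private (for all p, p' ∈ I_{≤n} with ‖p − p'‖₁ ≤ 1 and all sets S of outputs, Pr_{q∼A(p)}[q ∈ S] ≤ e^ε · Pr_{q∼A(p')}[q ∈ S]) and whose expected ℓ1-error satisfies E_{q∼A(p)}[‖q − p‖₁] ≤ C·√n·e^{−ε} for every p ∈ I_{≤n}. -/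
open scoped ENNReal

/-- The size of a partition, `∑_{i ≥ 1} p_i`. -/
noncomputable def psize (p : ℕ → ℕ) : ℕ := ∑ᶠ i : ℕ, p i

/-- `I_{≤ n}`: integer partitions of size at most `n`. -/
def PartLE (n : ℕ) : Type := {p : ℕ → ℕ // IsPartition p ∧ psize p ≤ n}

/-- discrete Laplace weight -/
noncomputable def lapW (a : ℝ≥0∞) (k : ℤ) : ℝ≥0∞ := a ^ k.natAbs

lemma tsum_int_natAbs_le (h : ℕ → ℝ≥0∞) :
    ∑' k : ℤ, h k.natAbs ≤ 2 * ∑' n : ℕ, h n := by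
  rw [tsum_of_nat_of_neg_add_one (f := fun k : ℤ => h k.natAbs) ENNReal.summable ENNReal.summable,
    two_mul]
  refine add_le_add (le_of_eq ?_) ?_
  · simp
  · have : ∀ n : ℕ, (-((n : ℤ) + 1)).natAbs = n + 1 := by intro n; omega
    simp only [this]
    exact ENNReal.tsum_comp_le_tsum_of_injective (add_left_injective 1) h

lemma lap_sums (r : ℝ) (h0 : 0 ≤ r) (h1 : r ≤ 1 / 2) :
    (∑' k : ℤ, lapW (ENNReal.ofReal r) k ≠ ∞) ∧
    ∑' k : ℤ, lapW (ENNReal.ofReal r) k * (k.natAbs : ℝ≥0∞) ≤ ENNReal.ofReal (8 * r) := by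
  have hr : ‖r‖ < 1 := by rw [Real.norm_of_nonneg h0]; linarith
  constructor
  · refine ne_top_of_le_ne_top ?_ (tsum_int_natAbs_le (fun n => (ENNReal.ofReal r) ^ n))
    rw [ENNReal.tsum_geometric]
    refine ENNReal.mul_ne_top (by simp) (ENNReal.inv_ne_top.2 ?_)
    rw [← ENNReal.ofReal_one, ← ENNReal.ofReal_sub _ h0]
    simp; linarith
  · refine (tsum_int_natAbs_le (fun n => (ENNReal.ofReal r) ^ n * (n : ℝ≥0∞))).trans ?_
    have hs := hasSum_coe_mul_geometric_of_norm_lt_one hr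
    have e : ∀ n : ℕ, (ENNReal.ofReal r) ^ n * (n : ℝ≥0∞) = ENNReal.ofReal (n * r ^ n) := by
      intro n
      rw [mul_comm, ENNReal.ofReal_mul (by positivity), ENNReal.ofReal_pow h0, ENNReal.ofReal_natCast]
    simp only [e]
    rw [← ENNReal.ofReal_tsum_of_nonneg (fun n => by positivity) hs.summable, hs.tsum_eq]
    rw [show (2 : ℝ≥0∞) = ENNReal.ofReal 2 by simp, ← ENNReal.ofReal_mul (by norm_num)]
    apply ENNReal.ofReal_le_ofReal
    have : r / (1 - r) ^ 2 ≤ 4 * r := by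
      rw [div_le_iff₀ (by nlinarith)]
      nlinarith [mul_nonneg h0 (by nlinarith : (0:ℝ) ≤ 4 * (1 - r) ^ 2 - 1)]
    linarith

/-- There is a one-dimensional noise distribution. -/
lemma exists_lap (r : ℝ) (h0 : 0 < r) (h1 : r ≤ 1 / 2) :
    ∃ L : PMF ℤ, (∀ x d : ℤ, L x * ENNReal.ofReal r ^ d.natAbs ≤ L (x + d)) ∧
      ∑' k : ℤ, L k * (k.natAbs : ℝ≥0∞) ≤ ENNReal.ofReal (8 * r) := by
  obtain ⟨ht, he⟩ := lap_sums r h0.le h1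
  have hone : 1 ≤ ∑' k : ℤ, lapW (ENNReal.ofReal r) k := by
    refine le_trans ?_ (ENNReal.le_tsum 0)
    simp [lapW]
  have hr1 : ENNReal.ofReal r ≤ 1 := by
    rw [← ENNReal.ofReal_one]; exact ENNReal.ofReal_le_ofReal (by linarith)
  refine ⟨PMF.normalize (lapW (ENNReal.ofReal r)) (by intro h; simp [h] at hone) ht, ?_, ?_⟩
  · intro x d
    rw [PMF.normalize_apply, PMF.normalize_apply, mul_right_comm]
    gcongr
    unfold lapW
    rw [← pow_add]
    exact pow_le_pow_of_le_one (zero_le) hr1 (by omega)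
  · refine le_trans (ENNReal.tsum_le_tsum fun k => ?_) he
    rw [PMF.normalize_apply]
    gcongr
    exact mul_le_of_le_one_right' (ENNReal.inv_le_one.2 hone)

open MeasureTheory in
/-- multi-dimensional noise -/
lemma exists_noise (ι : Type) [Fintype ι] (r : ℝ) (h0 : 0 < r) (h1 : r ≤ 1 / 2) :
    ∃ N : PMF (ι → ℤ),
      (∀ x d : ι → ℤ, N x * ENNReal.ofReal r ^ (∑ i, (d i).natAbs) ≤ N (x + d)) ∧
      ∑' z : ι → ℤ, N z * ((∑ i, (z i).natAbs : ℕ) : ℝ≥0∞) ≤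
        Fintype.card ι * ENNReal.ofReal (8 * r) := by
  obtain ⟨L, hL, hE⟩ := exists_lap r h0 h1
  let μ : Measure (ι → ℤ) := Measure.pi (fun _ => L.toMeasure)
  have hμ : ∀ z, μ.toPMF z = ∏ i, L (z i) := by
    intro z
    rw [Measure.toPMF_apply]
    simp only [μ]
    rw [Measure.pi_singleton]
    simp [PMF.toMeasure_apply_singleton]
  refine ⟨μ.toPMF, ?_, ?_⟩
  · intro x d
    rw [hμ, hμ, ← Finset.prod_pow_eq_pow_sum, ← Finset.prod_mul_distrib]
    exact Finset.prod_le_prod' fun i _ => hL _ _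
  · have key : ∀ i, ∑' z : ι → ℤ, μ.toPMF z * ((z i).natAbs : ℝ≥0∞) ≤ ENNReal.ofReal (8 * r) := by
      intro i
      have e1 : ∑' z : ι → ℤ, μ.toPMF z * ((z i).natAbs : ℝ≥0∞)
          = ∫⁻ z, ((z i).natAbs : ℝ≥0∞) ∂μ := by
        rw [lintegral_countable']
        refine tsum_congr fun z => ?_
        rw [Measure.toPMF_apply, mul_comm]
      have e2 : ∫⁻ z, ((z i).natAbs : ℝ≥0∞) ∂μ = ∫⁻ k : ℤ, (k.natAbs : ℝ≥0∞) ∂L.toMeasure :=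
        (measurePreserving_eval (fun _ : ι => L.toMeasure) i).lintegral_comp
          (f := fun k : ℤ => (k.natAbs : ℝ≥0∞)) (measurable_of_countable _)
      rw [e1, e2, lintegral_countable']
      refine le_trans (le_of_eq (tsum_congr fun k => ?_)) hE
      rw [PMF.toMeasure_apply_singleton _ _ (measurableSet_singleton _), mul_comm]
    calc _ = ∑' z : ι → ℤ, ∑ i, μ.toPMF z * ((z i).natAbs : ℝ≥0∞) := by
          refine tsum_congr fun z => ?_
          rw [Nat.cast_sum, Finset.mul_sum]
      _ = ∑ i, ∑' z : ι → ℤ, μ.toPMF z * ((z i).natAbs : ℝ≥0∞) :=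
          Summable.tsum_finsetSum fun _ _ => ENNReal.summable
      _ ≤ ∑ _i : ι, ENNReal.ofReal (8 * r) := Finset.sum_le_sum fun i _ => key i
      _ = _ := by simp

/-- Mechanism from an isometric embedding. -/
lemma mech (ι : Type) [Fintype ι] (n : ℕ) (F : PartLE n → ι → ℤ)
    (hF : ∀ p q : PartLE n, l1 p.1 q.1 = ∑ i, (F p i - F q i).natAbs)
    (ε : ℝ) (hε : 1 ≤ ε) :
      ∃ A : PartLE n → PMF (PartLE n),
        (∀ p p' : PartLE n, l1 p.1 p'.1 ≤ 1 → ∀ S : Set (PartLE n),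
          (A p).toOuterMeasure S ≤
            ENNReal.ofReal (Real.exp ε) * (A p').toOuterMeasure S) ∧
        (∀ p : PartLE n,
          (∑' q : PartLE n, A p q * (l1 q.1 p.1 : ℝ≥0∞)) ≤
            2 * (Fintype.card ι * ENNReal.ofReal (8 * Real.exp (-ε)))) := by
  classical
  have hr : Real.exp (-ε) ≤ 1 / 2 := by
    rw [Real.exp_neg, one_div]
    apply inv_anti₀ (by norm_num)
    linarith [Real.add_one_le_exp ε]
  obtain ⟨N, hN, hE⟩ := exists_noise ι (Real.exp (-ε)) (Real.exp_pos _) hr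
  have : Nonempty (PartLE n) := ⟨⟨fun _ => 0, ⟨fun _ _ _ => le_rfl, by simp [Function.support]⟩, by
    simp [psize]⟩⟩
  let g : (ι → ℤ) → PartLE n := fun w =>
    Function.argmin (fun p : PartLE n => ∑ i, (F p i - w i).natAbs)
  have hg : ∀ w p, l1 (g w).1 p.1 ≤ 2 * ∑ i, (w i - F p i).natAbs := by
    intro w p
    have h := Function.argmin_le (fun p : PartLE n => ∑ i, (F p i - w i).natAbs) p
    change ∑ i, (F (g w) i - w i).natAbs ≤ ∑ i, (F p i - w i).natAbs at h
    rw [hF]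
    have h2 : ∑ i, (F p i - w i).natAbs = ∑ i, (w i - F p i).natAbs :=
      Finset.sum_congr rfl fun i _ => by omega
    calc _ ≤ ∑ i, ((F (g w) i - w i).natAbs + (w i - F p i).natAbs) :=
          Finset.sum_le_sum fun i _ => by omega
      _ ≤ _ := by rw [Finset.sum_add_distrib]; omega
  refine ⟨fun p => N.map (fun z => g (F p + z)), ?_, ?_⟩
  · intro p p' hpp S
    rw [PMF.toOuterMeasure_map_apply, PMF.toOuterMeasure_map_apply,
      PMF.toOuterMeasure_apply, PMF.toOuterMeasure_apply, ← ENNReal.tsum_mul_left,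
      ← (Equiv.addRight (F p - F p')).tsum_eq
        (fun z => ENNReal.ofReal (Real.exp ε) * Set.indicator _ _ z)]
    refine ENNReal.tsum_le_tsum fun z => ?_
    simp only [Set.indicator_apply, Set.mem_preimage, Equiv.coe_addRight]
    have e : F p' + (z + (F p - F p')) = F p + z := by abel
    rw [e]
    split_ifs
    · have h := hN z (F p - F p')
      have hd : ∑ i, ((F p - F p') i).natAbs ≤ 1 := by
        rw [hF] at hpp; simpa using hpp
      have hr1 : ENNReal.ofReal (Real.exp (-ε)) ≤ 1 := by
        rw [← ENNReal.ofReal_one]; exact ENNReal.ofReal_le_ofReal (by linarith)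
      calc N z = ENNReal.ofReal (Real.exp ε) * (N z * ENNReal.ofReal (Real.exp (-ε)) ^ 1) := by
            rw [pow_one, mul_left_comm, ← ENNReal.ofReal_mul (Real.exp_pos _).le, ← Real.exp_add]
            simp
        _ ≤ ENNReal.ofReal (Real.exp ε) * (N z *
              ENNReal.ofReal (Real.exp (-ε)) ^ ∑ i, ((F p - F p') i).natAbs) := by
            gcongr 2
            exact pow_le_pow_of_le_one (zero_le) hr1 hd
        _ ≤ _ := by gcongr
    · simp
  · intro p
    have e : ∑' q : PartLE n, (N.map (fun z => g (F p + z))) q * (l1 q.1 p.1 : ℝ≥0∞)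
        = ∑' z, N z * (l1 (g (F p + z)).1 p.1 : ℝ≥0∞) := by
      simp only [PMF.map_apply, ← ENNReal.tsum_mul_right]
      rw [ENNReal.tsum_comm]
      refine tsum_congr fun z => ?_
      rw [tsum_eq_single (g (F p + z))]
      · simp
      · intro q hq
        simp [hq]
    rw [e]
    calc _ ≤ ∑' z : ι → ℤ, 2 * (N z * ((∑ i, (z i).natAbs : ℕ) : ℝ≥0∞)) := by
          refine ENNReal.tsum_le_tsum fun z => ?_
          have h := hg (F p + z) p
          simp only [Pi.add_apply, add_sub_cancel_left] at h
          rw [mul_left_comm]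
          gcongr
          exact_mod_cast h
      _ ≤ _ := by rw [ENNReal.tsum_mul_left]; gcongr

lemma part_bound {n : ℕ} (p : PartLE n) (i : ℕ) : (i + 1) * p.1 i ≤ n := by
  obtain ⟨p, ⟨ha, hf⟩, hs⟩ := p
  change (i + 1) * p i ≤ n
  refine le_trans ?_ hs
  unfold psize
  rw [finsum_eq_sum_of_support_subset (s := hf.toFinset ∪ Finset.range (i + 1)) _ (by
    intro x hx; simp; left; simpa using hx)]
  calc (i + 1) * p i = ∑ _j ∈ Finset.range (i + 1), p i := by simp
    _ ≤ ∑ j ∈ Finset.range (i + 1), p j := Finset.sum_le_sum fun j hj => ha (by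
        simp at hj; omega)
    _ ≤ _ := Finset.sum_le_sum_of_subset Finset.subset_union_right

lemma abs_sum_same {α : Type} (s : Finset α) (f : α → ℤ)
    (h : (∀ i ∈ s, 0 ≤ f i) ∨ (∀ i ∈ s, f i ≤ 0)) : |∑ i ∈ s, f i| = ∑ i ∈ s, |f i| := by
  rcases h with h | h
  · rw [abs_of_nonneg (Finset.sum_nonneg h)]
    exact Finset.sum_congr rfl fun i hi => (abs_of_nonneg (h i hi)).symm
  · rw [abs_of_nonpos (Finset.sum_nonpos h), ← Finset.sum_neg_distrib]
    exact Finset.sum_congr rfl fun i hi => (abs_of_nonpos (h i hi)).symm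

/-- indicator of a cell of the diagram -/
def cell (j p : ℕ) : ℤ := if j < p then 1 else 0

lemma sum_cell (k p : ℕ) (h : p ≤ k) : ∑ j ∈ Finset.range k, cell j p = p := by
  unfold cell
  rw [← Finset.sum_filter]
  have : (Finset.range k).filter (fun j => j < p) = Finset.range p := by
    ext j; simp; omega
  simp [this]

lemma abs_sub_cells (k p q : ℕ) (hp : p ≤ k) (hq : q ≤ k) :
    |(p : ℤ) - q| = ∑ j ∈ Finset.range k, |cell j p - cell j q| := by
  rw [← sum_cell k p hp, ← sum_cell k q hq, ← Finset.sum_sub_distrib, abs_sum_same]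
  rcases le_total p q with h | h
  · right; intro i _; unfold cell; split_ifs <;> omega
  · left; intro i _; unfold cell; split_ifs <;> omega

lemma col_abs (p q : ℕ → ℕ) (hp : Antitone p) (hq : Antitone q) (s : Finset ℕ) (j : ℕ) :
    |∑ i ∈ s, cell j (p i) - ∑ i ∈ s, cell j (q i)| = ∑ i ∈ s, |cell j (p i) - cell j (q i)| := by
  rw [← Finset.sum_sub_distrib, abs_sum_same]
  by_cases h : ∀ i, j < p i → j < q i
  · right; intro i _; have := h i; unfold cell; split_ifs <;> omega
  · left
    push Not at h
    obtain ⟨i0, h1, h2⟩ := h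
    intro i _
    have : j < q i → j < p i := by
      intro hi
      rcases le_total i i0 with h | h
      · exact h1.trans_le (hp h)
      · have := hq h; omega
    unfold cell; split_ifs <;> omega

/-- The embedding: first rows, then columns of the remainder. -/
def emb (n k : ℕ) (p : PartLE n) : Fin k ⊕ Fin k → ℤ
  | Sum.inl i => p.1 i
  | Sum.inr j => ∑ i ∈ Finset.Ico k n, cell j (p.1 i)

lemma emb_iso (n : ℕ) (p q : PartLE n) :
    l1 p.1 q.1 = ∑ i, (emb n n.sqrt p i - emb n n.sqrt q i).natAbs := by
  have hk : n.sqrt ≤ n := Nat.sqrt_le_self n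
  have hz : ∀ (p : PartLE n) i, n ≤ i → p.1 i = 0 := by
    intro p i hi
    have := part_bound p i
    by_contra h
    have : i + 1 ≤ (i + 1) * p.1 i := Nat.le_mul_of_pos_right _ (Nat.pos_of_ne_zero h)
    omega
  have hb : ∀ (p : PartLE n) i, n.sqrt ≤ i → p.1 i ≤ n.sqrt := by
    intro p i hi
    have h1 := part_bound p i
    have h2 := Nat.lt_succ_sqrt n
    simp only [Nat.succ_eq_add_one] at h2
    by_contra h
    nlinarith
  zify
  rw [Fintype.sum_sum_type]
  unfold l1
  rw [finsum_eq_sum_of_support_subset (s := Finset.range n) _ (by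
    intro x hx
    by_contra h
    simp at h
    simp [hz p x h, hz q x h] at hx)]
  push_cast
  rw [Finset.range_eq_Ico, ← Finset.sum_Ico_consecutive _ (Nat.zero_le _) hk,
    ← Finset.range_eq_Ico]
  congr 1
  · simp only [emb]
    exact Finset.sum_range (fun i => |(p.1 i : ℤ) - q.1 i|)
  · simp only [emb]
    rw [← Finset.sum_range (fun j => |∑ i ∈ Finset.Ico n.sqrt n, cell j (p.1 i) -
      ∑ i ∈ Finset.Ico n.sqrt n, cell j (q.1 i)|)]
    simp only [col_abs _ _ p.2.1.1 q.2.1.1]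
    rw [Finset.sum_comm]
    refine Finset.sum_congr rfl fun i hi => ?_
    have hi := (Finset.mem_Ico.1 hi).1
    exact abs_sub_cells _ _ _ (hb p i hi) (hb q i hi)

/-- There is an absolute constant `C > 0` such that for every `ε ≥ 1` and every `n`
there is an `ε`-DP randomized algorithm `A : I_{≤n} → PMF(I_{≤n})` whose expected
ℓ1-error is at most `C · √n · e^{−ε}` on every input `p ∈ I_{≤n}`. -/
theorem low_privacy_upper_bound :
    ∃ C : ℝ, 0 < C ∧ ∀ ε : ℝ, 1 ≤ ε → ∀ n : ℕ,
      ∃ A : PartLE n → PMF (PartLE n),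
        (∀ p p' : PartLE n, l1 p.1 p'.1 ≤ 1 → ∀ S : Set (PartLE n),
          (A p).toOuterMeasure S ≤
            ENNReal.ofReal (Real.exp ε) * (A p').toOuterMeasure S) ∧
        (∀ p : PartLE n,
          (∑' q : PartLE n, A p q * (l1 q.1 p.1 : ℝ≥0∞)) ≤
            ENNReal.ofReal (C * Real.sqrt n * Real.exp (-ε))) := by
  refine ⟨32, by norm_num, fun ε hε n => ?_⟩
  obtain ⟨A, h1, h2⟩ := mech _ n (emb n n.sqrt) (emb_iso n) ε hε
  refine ⟨A, h1, fun p => (h2 p).trans ?_⟩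
  rw [← ENNReal.ofReal_natCast, ← ENNReal.ofReal_mul (by positivity),
    show (2 : ℝ≥0∞) = ENNReal.ofReal 2 by simp, ← ENNReal.ofReal_mul (by norm_num)]
  apply ENNReal.ofReal_le_ofReal
  have h3 : (n.sqrt : ℝ) ≤ Real.sqrt n := Real.nat_sqrt_le_real_sqrt
  have h4 := mul_le_mul_of_nonneg_right h3 (Real.exp_pos (-ε)).le
  simp only [Fintype.card_sum, Fintype.card_fin, Nat.cast_add]
  nlinarith
end

section
/- Let n, Δ ∈ ℕ be such that n ≥ Δ and Δ > 10·√n. Then there exist a natural number m with m ≥ (1/8)·(n/Δ)·log₂(Δ/√n) and a map ψ : {0,1}^m → I_{≤n} such that for all distinct y, z ∈ {0,1}^m, (Δ/(8m))·‖y − z‖₁ ≤ ‖ψ(y) − ψ(z)‖₁ ≤ (Δ/(2m))·‖y − z‖₁, where ‖y − z‖₁ denotes the Hamming distance between the boolean vectors. -/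
/-- Starting position of block `s`, with block widths `a`. -/
def blockStart (a : ℕ → ℕ) (s : ℕ) : ℕ := ∑ r ∈ Finset.range s, a r

theorem blockStart_succ (a : ℕ → ℕ) (s : ℕ) :
    blockStart a (s + 1) = blockStart a s + a s := Finset.sum_range_succ _ _

theorem blockStart_mono (a : ℕ → ℕ) : Monotone (blockStart a) :=
  monotone_nat_of_le_succ fun s => by rw [blockStart_succ]; omega

/-- One layer: the height `b` on the columns before `S + y * a`. -/
def layer (S a b : ℕ) (y : Bool) (x : ℕ) : ℕ := if x < S + (if y then a else 0) then b else 0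

/-- The staircase partition. -/
def stair (a b : ℕ → ℕ) (m : ℕ) (y : Fin m → Bool) (x : ℕ) : ℕ :=
  ∑ s : Fin m, layer (blockStart a s) (a s) (b s) (y s) x

theorem layer_zero (a : ℕ → ℕ) (s m : ℕ) (hs : s < m) (b : ℕ) (y : Bool) (x : ℕ)
    (hx : blockStart a m ≤ x) : layer (blockStart a s) (a s) b y x = 0 := by
  have h := blockStart_mono a (Nat.succ_le_of_lt hs)
  rw [Nat.succ_eq_add_one, blockStart_succ] at h
  unfold layer
  rw [if_neg]
  split_ifs <;> omega

theorem stair_zero (a b : ℕ → ℕ) (m : ℕ) (y : Fin m → Bool) (x : ℕ)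
    (hx : blockStart a m ≤ x) : stair a b m y x = 0 :=
  Finset.sum_eq_zero fun s _ => layer_zero a s m s.2 _ _ _ hx

theorem stair_partition (a b : ℕ → ℕ) (m : ℕ) (y : Fin m → Bool) :
    IsPartition (stair a b m y) := by
  constructor
  · intro x x' h
    refine Finset.sum_le_sum fun s _ => ?_
    unfold layer
    split_ifs <;> omega
  · refine (Finset.range (blockStart a m)).finite_toSet.subset fun x hx => ?_
    by_contra h
    simp at h
    exact hx (stair_zero a b m y x h)

theorem layer_sum (S a b N : ℕ) (y : Bool) :
    ∑ x ∈ Finset.range N, layer S a b y x ≤ (S + a) * b := by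
  unfold layer
  rw [← Finset.sum_filter, Finset.sum_const, smul_eq_mul]
  refine Nat.mul_le_mul_right _ ?_
  calc _ ≤ (Finset.range (S + a)).card := by
        refine Finset.card_le_card fun x hx => ?_
        simp only [Finset.mem_filter, Finset.mem_range] at hx ⊢
        have := hx.2
        split_ifs at this <;> omega
    _ = _ := Finset.card_range _

theorem stair_size (a b : ℕ → ℕ) (m : ℕ) (y : Fin m → Bool) :
    psize (stair a b m y) ≤ ∑ s : Fin m, blockStart a (s + 1) * b s := by
  unfold psize
  rw [finsum_eq_sum_of_support_subset (s := Finset.range (blockStart a m))]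
  · unfold stair
    rw [Finset.sum_comm]
    refine Finset.sum_le_sum fun s _ => ?_
    rw [blockStart_succ]
    exact layer_sum _ _ _ _ _
  · intro x hx
    by_contra h
    simp at h
    exact hx (stair_zero a b m y x h)

theorem natAbs_sum_single {ι : Type*} [Fintype ι] (f : ι → ℤ)
    (h : ∀ s r, f s ≠ 0 → f r ≠ 0 → s = r) :
    (∑ s, f s).natAbs = ∑ s, (f s).natAbs := by
  by_cases h0 : ∃ s, f s ≠ 0
  · obtain ⟨s, hs⟩ := h0
    have hz : ∀ r, r ≠ s → f r = 0 := fun r hr => by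
      by_contra h'
      exact hr (h r s h' hs)
    rw [Fintype.sum_eq_single s hz,
      Fintype.sum_eq_single s (fun r hr => by rw [hz r hr]; rfl)]
  · push Not at h0
    simp [h0]

theorem layer_diff (S a b x : ℕ) (y z : Bool)
    (h : (layer S a b y x : ℤ) - layer S a b z x ≠ 0) : S ≤ x ∧ x < S + a := by
  unfold layer at h
  cases y <;> cases z <;> simp at h ⊢ <;> split_ifs at h <;> omega

theorem layer_diff_sum (S a b N : ℕ) (hN : S + a ≤ N) (y z : Bool) :
    ∑ x ∈ Finset.range N, ((layer S a b y x : ℤ) - layer S a b z x).natAbs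
      = if y ≠ z then a * b else 0 := by
  have key : ∀ x, ((layer S a b y x : ℤ) - layer S a b z x).natAbs
      = if y ≠ z then (if x ∈ Finset.Ico S (S + a) then b else 0) else 0 := by
    intro x
    unfold layer
    simp only [Finset.mem_Ico]
    cases y <;> cases z <;> simp <;> split_ifs <;> omega
  simp only [key]
  split_ifs with h
  · rw [Finset.sum_ite_mem, Finset.inter_eq_right.mpr, Finset.sum_const, Nat.card_Ico, smul_eq_mul]
    · congr 1; omega
    · intro x hx
      simp at hx ⊢
      omega
  · simp

theorem stair_l1 (a b : ℕ → ℕ) (m d : ℕ) (hd : ∀ s < m, a s * b s = d) (y z : Fin m → Bool) :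
    l1 (stair a b m y) (stair a b m z) = d * hammingDist y z := by
  unfold l1
  rw [finsum_eq_sum_of_support_subset (s := Finset.range (blockStart a m))]
  · have : ∀ x, ((stair a b m y x : ℤ) - stair a b m z x).natAbs =
        ∑ s : Fin m, ((layer (blockStart a s) (a s) (b s) (y s) x : ℤ) -
          layer (blockStart a s) (a s) (b s) (z s) x).natAbs := by
      intro x
      unfold stair
      push_cast
      rw [← Finset.sum_sub_distrib]
      refine natAbs_sum_single _ fun s r hs hr => ?_
      have h1 := layer_diff _ _ _ _ _ _ hs
      have h2 := layer_diff _ _ _ _ _ _ hr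
      rw [← blockStart_succ] at h1 h2
      by_contra hne
      rcases lt_or_gt_of_ne hne with h | h
      · have := blockStart_mono a (show (s : ℕ) + 1 ≤ r from h)
        omega
      · have := blockStart_mono a (show (r : ℕ) + 1 ≤ s from h)
        omega
    simp only [this]
    rw [Finset.sum_comm]
    have h2 : ∀ s : Fin m, ∑ x ∈ Finset.range (blockStart a m),
        ((layer (blockStart a s) (a s) (b s) (y s) x : ℤ) -
          layer (blockStart a s) (a s) (b s) (z s) x).natAbs = if y s ≠ z s then d else 0 := by
      intro s
      rw [layer_diff_sum, hd s s.2]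
      rw [← blockStart_succ]
      exact blockStart_mono a s.2
    simp only [h2]
    rw [← Finset.sum_filter, Finset.sum_const, smul_eq_mul, mul_comm]
    rfl
  · intro x hx
    by_contra h
    simp at h
    refine hx ?_
    simp [stair_zero _ _ _ _ _ h]

theorem start_bound (t : ℕ) (ht : 0 < t) (s : ℕ) :
    blockStart (fun s => 2 ^ (s / t)) s ≤ (t + s % t) * 2 ^ (s / t) := by
  induction s with
  | zero => simp [blockStart]
  | succ s ih =>
    rw [blockStart_succ]
    by_cases h : s % t + 1 < t
    · have e : s + 1 = (s % t + 1) + t * (s / t) := by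
        have := Nat.mod_add_div s t
        omega
      have e1 : (s + 1) / t = s / t := by
        rw [e, Nat.add_mul_div_left _ _ ht, Nat.div_eq_of_lt h, zero_add]
      have e2 : (s + 1) % t = s % t + 1 := by
        rw [e, Nat.add_mul_mod_self_left, Nat.mod_eq_of_lt h]
      rw [e1, e2]
      nlinarith
    · have h' : s % t + 1 = t := by
        have := Nat.mod_lt s ht
        omega
      have e : s + 1 = t * (s / t + 1) := by
        have := Nat.mod_add_div s t
        rw [mul_add]
        omega
      have e1 : (s + 1) / t = s / t + 1 := by
        rw [e, Nat.mul_div_cancel_left _ ht]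
      rw [e1, pow_succ]
      have hh : (t + s % t) * 2 ^ (s / t) + 2 ^ (s / t) = t * (2 ^ (s / t) * 2) := by
        calc _ = (t + (s % t + 1)) * 2 ^ (s / t) := by ring
          _ = _ := by rw [h']; ring
      nlinarith [Nat.zero_le (((s + 1) % t) * (2 ^ (s / t) * 2))]

theorem exists_level (t D : ℕ) (h : 2 * t ≤ D) (ht : 0 < t) :
    ∃ K, 1 ≤ K ∧ K * 2 ^ K * t ≤ D ∧ D < (K + 1) * 2 ^ (K + 1) * t := by
  have hP : ∃ K, D < (K + 1) * 2 ^ (K + 1) * t := by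
    refine ⟨D, ?_⟩
    have h1 : 1 ≤ 2 ^ (D + 1) := Nat.one_le_two_pow
    calc D < (D + 1) * 1 * 1 := by omega
      _ ≤ _ := Nat.mul_le_mul (Nat.mul_le_mul le_rfl h1) ht
  classical
  refine ⟨Nat.find hP, ?_, ?_, Nat.find_spec hP⟩
  · rw [Nat.one_le_iff_ne_zero]
    intro h0
    have := Nat.find_spec hP
    rw [h0] at this
    norm_num at this
    omega
  · rcases hk : Nat.find hP with _ | k
    · simp
    · have := Nat.find_min hP (m := k) (by omega)
      omega

/-- Key encoding lemma: for `n ≥ Δ > 10√n` there exist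
`m ≥ (1/8)·(n/Δ)·log₂(Δ/√n)` and `ψ : {0,1}^m → I_{≤n}` such that for all distinct
`y, z`, `(Δ/(8m))·‖y−z‖₁ ≤ ‖ψ(y)−ψ(z)‖₁ ≤ (Δ/(2m))·‖y−z‖₁`, where `‖y−z‖₁` is the
Hamming distance. -/
theorem encoding_lemma (n Δ : ℕ) (h1 : Δ ≤ n) (h2 : 10 * Real.sqrt n < (Δ : ℝ)) :
    ∃ m : ℕ,
      (1 / 8 : ℝ) * ((n : ℝ) / (Δ : ℝ)) * Real.logb 2 ((Δ : ℝ) / Real.sqrt n) ≤ (m : ℝ) ∧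
      ∃ ψ : (Fin m → Bool) → PartLE n,
        ∀ y z : Fin m → Bool, y ≠ z →
          ((Δ : ℝ) / (8 * m)) * (hammingDist y z : ℝ) ≤ (l1 (ψ y).1 (ψ z).1 : ℝ) ∧
          (l1 (ψ y).1 (ψ z).1 : ℝ) ≤ ((Δ : ℝ) / (2 * m)) * (hammingDist y z : ℝ) := by
  have hn0 : 0 < n := by
    rcases Nat.eq_zero_or_pos n with h | h
    · subst h
      have : Δ = 0 := by omega
      subst this
      simp at h2
    · exact h
  have hnR : (0 : ℝ) < n := by exact_mod_cast hn0
  have hsq : 0 < Real.sqrt n := Real.sqrt_pos.mpr hnR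
  have hss : Real.sqrt n * Real.sqrt n = n := Real.mul_self_sqrt hnR.le
  have hDR : (0 : ℝ) < Δ := by linarith
  have hD0 : 0 < Δ := by exact_mod_cast hDR
  have hD2 : (100 : ℝ) * n < Δ * Δ := by nlinarith
  have hD2' : 100 * n < Δ * Δ := by exact_mod_cast hD2
  obtain ⟨t, ht⟩ : ∃ t, t = n / Δ := ⟨_, rfl⟩
  have ht0 : 0 < t := by rw [ht]; exact Nat.div_pos h1 hD0
  have htn : Δ * t ≤ n := by rw [ht]; exact Nat.mul_div_le n Δ
  have hnt : n < Δ * (t + 1) := by rw [ht]; exact Nat.lt_mul_div_succ n hD0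
  have h2t : 2 * t ≤ Δ := by
    by_contra hc
    push Not at hc
    nlinarith
  obtain ⟨K, hK1, hKle, hKlt⟩ := exists_level t Δ h2t ht0
  have hKpow : K + 1 ≤ 2 ^ K := Nat.lt_two_pow_self
  have hm0 : 0 < K * t := Nat.mul_pos hK1 ht0
  have hmR : (0 : ℝ) < ((K * t : ℕ) : ℝ) := by exact_mod_cast hm0
  have hpowK : 2 ^ K = 2 * 2 ^ (K - 1) := by
    rw [← pow_succ']
    congr 1
    omega
  have hdiv : ∀ s, s < K * t → s / t ≤ K - 1 := by
    intro s hs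
    have : s / t < K := Nat.div_lt_of_lt_mul (by rwa [mul_comm])
    omega
  have hab : ∀ s < K * t, (fun s => 2 ^ (s / t)) s * (fun s => 2 ^ (K - 1 - s / t)) s
      = 2 ^ (K - 1) := by
    intro s hs
    have := hdiv s hs
    dsimp only
    rw [← pow_add]
    congr 1
    omega
  have hsize : ∀ y : Fin (K * t) → Bool,
      psize (stair (fun s => 2 ^ (s / t)) (fun s => 2 ^ (K - 1 - s / t)) (K * t) y) ≤ n := by
    intro y
    refine (stair_size _ _ _ y).trans ?_
    have hb : ∀ s : Fin (K * t), blockStart (fun s => 2 ^ (s / t)) (s + 1) *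
        (fun s => 2 ^ (K - 1 - s / t)) (s : ℕ) ≤ 2 * t * 2 ^ (K - 1) := by
      intro s
      rw [← hab s s.2, ← mul_assoc]
      refine Nat.mul_le_mul_right _ ?_
      rw [blockStart_succ]
      have e1 := start_bound t ht0 s
      have e2 := Nat.mod_lt (s : ℕ) ht0
      calc _ ≤ (t + (s : ℕ) % t) * 2 ^ ((s : ℕ) / t) + 2 ^ ((s : ℕ) / t) :=
            Nat.add_le_add_right e1 _
        _ = (t + (s : ℕ) % t + 1) * 2 ^ ((s : ℕ) / t) := by ring
        _ ≤ _ := Nat.mul_le_mul_right _ (by omega)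
    refine (Finset.sum_le_sum fun s _ => hb s).trans ?_
    rw [Finset.sum_const, Finset.card_univ, Fintype.card_fin, smul_eq_mul]
    calc K * t * (2 * t * 2 ^ (K - 1)) = (K * 2 ^ K * t) * t := by rw [hpowK]; ring
      _ ≤ Δ * t := Nat.mul_le_mul_right _ hKle
      _ ≤ n := htn
  refine ⟨K * t, ?_, fun y => ⟨_, stair_partition _ _ _ y, hsize y⟩, ?_⟩
  · have hlog : Real.logb 2 ((Δ : ℝ) / Real.sqrt n) ≤ 4 * K := by
      rw [Real.logb_le_iff_le_rpow (by norm_num) (by positivity)]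
      have e : (2 : ℝ) ^ ((4 : ℝ) * K) = 2 ^ (4 * K) := by
        rw [← Real.rpow_natCast]
        push_cast
        rfl
      rw [e, div_le_iff₀ hsq]
      have hA : Δ * Δ ≤ 2 ^ (4 * K) * 2 ^ (4 * K) * n := by
        have b1 : (K + 1) * 2 ^ (K + 1) ≤ 2 ^ (4 * K) * 2 ^ (4 * K) := by
          calc _ ≤ 2 ^ K * 2 ^ (K + 1) := Nat.mul_le_mul_right _ hKpow
            _ = 2 ^ (K + (K + 1)) := (pow_add _ _ _).symm
            _ ≤ 2 ^ (4 * K + 4 * K) := Nat.pow_le_pow_right (by norm_num) (by omega)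
            _ = _ := pow_add _ _ _
        calc Δ * Δ ≤ Δ * ((K + 1) * 2 ^ (K + 1) * t) := Nat.mul_le_mul_left _ hKlt.le
          _ = ((K + 1) * 2 ^ (K + 1)) * (Δ * t) := by ring
          _ ≤ _ := Nat.mul_le_mul b1 htn
      have hA' : (Δ : ℝ) * Δ ≤ 2 ^ (4 * K) * 2 ^ (4 * K) * n := by exact_mod_cast hA
      refine abs_le_of_sq_le_sq' ?_ (by positivity) |>.2
      calc (Δ : ℝ) ^ 2 = Δ * Δ := by ring
        _ ≤ 2 ^ (4 * K) * 2 ^ (4 * K) * n := hA'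
        _ = _ := by rw [mul_pow, Real.sq_sqrt hnR.le]; ring
    have hq : (n : ℝ) / Δ ≤ 2 * t := by
      rw [div_le_iff₀ hDR]
      have : n ≤ 2 * t * Δ := by nlinarith
      exact_mod_cast this
    have hq0 : 0 ≤ (n : ℝ) / Δ := by positivity
    calc _ ≤ (1 / 8 : ℝ) * ((n : ℝ) / (Δ : ℝ)) * (4 * K) :=
          mul_le_mul_of_nonneg_left hlog (by positivity)
      _ ≤ (1 / 8 : ℝ) * (2 * t) * (4 * K) := by gcongr
      _ = _ := by push_cast; ring
  · intro y z _
    dsimp only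
    rw [stair_l1 _ _ _ _ hab]
    have u1 : Δ ≤ 2 ^ (K - 1) * (8 * (K * t)) := by
      calc Δ ≤ (K + 1) * 2 ^ (K + 1) * t := hKlt.le
        _ ≤ (2 * K) * 2 ^ (K + 1) * t := by gcongr; omega
        _ = _ := by rw [pow_succ, hpowK]; ring
    have u2 : 2 ^ (K - 1) * (2 * (K * t)) ≤ Δ := by
      calc _ = K * 2 ^ K * t := by rw [hpowK]; ring
        _ ≤ _ := hKle
    rw [Nat.cast_mul (2 ^ (K - 1)) (hammingDist y z)]
    constructor
    · refine mul_le_mul_of_nonneg_right ?_ (Nat.cast_nonneg _)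
      rw [div_le_iff₀ (by positivity)]
      exact_mod_cast u1
    · refine mul_le_mul_of_nonneg_right ?_ (Nat.cast_nonneg _)
      rw [le_div_iff₀ (by positivity)]
      exact_mod_cast u2
end

section
/- Let ε, δ > 0 and m ∈ ℕ. For any randomized algorithm M : {0,1}^m → PMF({0,1}^m) that is (ε,δ)-differentially private with respect to Hamming neighbors (vectors differing in at most one coordinate), the expected error over a uniformly random input satisfies E_{z uniform on {0,1}^m} E_{w∼M(z)}[‖w − z‖₁] ≥ e^{−ε} · m · (1 − δ)/2. -/
open scoped ENNReal

/-- Lower bound for privatizing boolean vectors: if `M : {0,1}^m → PMF({0,1}^m)` is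
`(ε,δ)`-DP with respect to Hamming neighbors, then the expected Hamming error over a
uniformly random input is at least `e^{−ε} · m · (1−δ)/2`. -/
theorem boolean_vector_lower_bound (ε δ : ℝ) (hε : 0 < ε) (hδ : 0 < δ) (m : ℕ)
    (M : (Fin m → Bool) → PMF (Fin m → Bool))
    (hDP : ∀ z z' : Fin m → Bool, hammingDist z z' ≤ 1 →
      ∀ S : Set (Fin m → Bool),
        (M z).toOuterMeasure S ≤
          ENNReal.ofReal (Real.exp ε) * (M z').toOuterMeasure S + ENNReal.ofReal δ) :
    ENNReal.ofReal (Real.exp (-ε) * m * (1 - δ) / 2) ≤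
      (∑ z : Fin m → Bool, ∑' w : Fin m → Bool, M z w * (hammingDist w z : ℝ≥0∞)) /
        2 ^ m := by
  classical
  set P : (Fin m → Bool) → (Fin m → Bool) → ℝ := fun z w => (M z w).toReal with hP
  have hP0 : ∀ z w, 0 ≤ P z w := fun z w => ENNReal.toReal_nonneg
  have hMP : ∀ z w, M z w = ENNReal.ofReal (P z w) := fun z w =>
    (ENNReal.ofReal_toReal ((M z).apply_ne_top w)).symm
  have hP1 : ∀ z, ∑ w, P z w = 1 := by
    intro z
    have h := (M z).tsum_coe
    rw [tsum_fintype] at h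
    have h2 := congrArg ENNReal.toReal h
    rw [ENNReal.toReal_sum (fun w _ => (M z).apply_ne_top w)] at h2
    simpa using h2
  have hS : ∀ z (S : Set (Fin m → Bool)), (M z).toOuterMeasure S =
      ENNReal.ofReal (∑ w, if w ∈ S then P z w else 0) := by
    intro z S
    rw [PMF.toOuterMeasure_apply_fintype, ENNReal.ofReal_sum_of_nonneg]
    · refine Finset.sum_congr rfl fun w _ => ?_
      by_cases hw : w ∈ S <;> simp [hw, hMP]
    · intro w _
      split_ifs
      · exact hP0 z w
      · exact le_rfl
  have hS0 : ∀ z (S : Set (Fin m → Bool)), 0 ≤ ∑ w, if w ∈ S then P z w else 0 := by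
    intro z S
    refine Finset.sum_nonneg fun w _ => ?_
    split_ifs
    · exact hP0 z w
    · exact le_rfl
  have hDP' : ∀ z z' : Fin m → Bool, hammingDist z z' ≤ 1 → ∀ S : Set (Fin m → Bool),
      (∑ w, if w ∈ S then P z w else 0) ≤
        Real.exp ε * (∑ w, if w ∈ S then P z' w else 0) + δ := by
    intro z z' hz S
    have h := hDP z z' hz S
    rw [hS, hS, ← ENNReal.ofReal_mul (Real.exp_pos ε).le, ← ENNReal.ofReal_add
      (mul_nonneg (Real.exp_pos ε).le (hS0 z' S)) hδ.le, ENNReal.ofReal_le_ofReal_iff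
      (add_nonneg (mul_nonneg (Real.exp_pos ε).le (hS0 z' S)) hδ.le)] at h
    exact h
  set q : (Fin m → Bool) → Fin m → ℝ := fun z i => ∑ w, if w i ≠ z i then P z w else 0 with hq
  have hq0 : ∀ z i, 0 ≤ q z i := by
    intro z i
    refine Finset.sum_nonneg fun w _ => ?_
    split_ifs
    · exact hP0 z w
    · exact le_rfl
  let fl : Fin m → (Fin m → Bool) → (Fin m → Bool) := fun i z => Function.update z i (!z i)
  have hfl : ∀ i, Function.Involutive (fl i) := by
    intro i z
    simp [fl]
  have key : ∀ z i, 1 - q z i ≤ Real.exp ε * q (fl i z) i + δ := by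
    intro z i
    have hd : hammingDist z (fl i z) ≤ 1 := by
      unfold hammingDist
      calc _ ≤ ({i} : Finset (Fin m)).card := by
            apply Finset.card_le_card
            intro j hj
            by_contra hne
            simp only [Finset.mem_singleton] at hne
            simp [fl, Function.update_of_ne hne] at hj
        _ = 1 := by simp
    have h := hDP' z (fl i z) hd {w | w i = z i}
    have e1 : (∑ w, if w ∈ {w : Fin m → Bool | w i = z i} then P z w else 0) = 1 - q z i := by
      rw [← hP1 z, hq, eq_sub_iff_add_eq, ← Finset.sum_add_distrib]
      refine Finset.sum_congr rfl fun w _ => ?_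
      by_cases hw : w i = z i <;> simp [hw]
    have e2 : (∑ w, if w ∈ {w : Fin m → Bool | w i = z i} then P (fl i z) w else 0)
        = q (fl i z) i := by
      refine Finset.sum_congr rfl fun w _ => ?_
      have : (w i = z i) ↔ (w i ≠ fl i z i) := by
        simp only [fl, Function.update_self]
        cases w i <;> cases z i <;> simp
      simp only [Set.mem_ofPred_eq, this]
    rw [← e1, ← e2]
    convert h
  have hQ : ∀ i, Real.exp (-ε) * (1 - δ) / 2 * 2 ^ m ≤ ∑ z, q z i := by
    intro i
    have hQ0 : 0 ≤ ∑ z, q z i := Finset.sum_nonneg fun z _ => hq0 z i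
    have h := Finset.sum_le_sum (s := Finset.univ) fun z _ => key z i
    have e := Equiv.sum_comp (hfl i).toPerm (fun z => q z i)
    simp only [Function.Involutive.coe_toPerm] at e
    rw [Finset.sum_sub_distrib, Finset.sum_add_distrib, ← Finset.mul_sum, e] at h
    simp at h
    have he : 1 ≤ Real.exp ε := Real.one_le_exp hε.le
    have h3 : (2 : ℝ) ^ m * (1 - δ) ≤ 2 * Real.exp ε * ∑ z, q z i := by nlinarith
    rw [Real.exp_neg]
    have hpos := Real.exp_pos ε
    have : (Real.exp ε)⁻¹ * (1 - δ) / 2 * 2 ^ m = (2 ^ m * (1 - δ)) / (2 * Real.exp ε) := by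
      field_simp
    rw [this, div_le_iff₀ (by positivity)]
    linarith
  have hR : ∑ z : Fin m → Bool, ∑' w : Fin m → Bool, M z w * (hammingDist w z : ℝ≥0∞) =
      ENNReal.ofReal (∑ z, ∑ w, P z w * (hammingDist w z : ℝ)) := by
    rw [ENNReal.ofReal_sum_of_nonneg (fun z _ => Finset.sum_nonneg fun w _ =>
      mul_nonneg (hP0 z w) (Nat.cast_nonneg _))]
    refine Finset.sum_congr rfl fun z _ => ?_
    rw [tsum_fintype, ENNReal.ofReal_sum_of_nonneg (fun w _ =>
      mul_nonneg (hP0 z w) (Nat.cast_nonneg _))]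
    refine Finset.sum_congr rfl fun w _ => ?_
    rw [ENNReal.ofReal_mul (hP0 z w), ENNReal.ofReal_natCast, hMP]
  have hT : ∑ z, ∑ w, P z w * (hammingDist w z : ℝ) = ∑ i, ∑ z, q z i := by
    rw [Finset.sum_comm (s := (Finset.univ : Finset (Fin m)))]
    refine Finset.sum_congr rfl fun z _ => ?_
    rw [hq, Finset.sum_comm]
    refine Finset.sum_congr rfl fun w _ => ?_
    unfold hammingDist
    rw [Finset.card_filter]
    push_cast
    rw [Finset.mul_sum]
    refine Finset.sum_congr rfl fun i _ => ?_
    split_ifs <;> simp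
  have h2 : (2 : ℝ≥0∞) ^ m = ENNReal.ofReal (2 ^ m) := by
    rw [ENNReal.ofReal_pow (by norm_num)]
    simp
  rw [hR, h2, ← ENNReal.ofReal_div_of_pos (by positivity), hT]
  apply ENNReal.ofReal_le_ofReal
  rw [le_div_iff₀ (by positivity)]
  have h := Finset.sum_le_sum (s := Finset.univ) fun i _ => hQ i
  simp only [Finset.sum_const, Finset.card_univ, Fintype.card_fin, nsmul_eq_mul] at h
  refine le_trans (le_of_eq ?_) h
  ring
end

section
/- Let ε > 0, δ ∈ [0, 0.9), and n ∈ ℕ. Every (ε,δ)-differentially private randomized algorithm A : I_{≤n} → PMF(I) satisfies max_{p ∈ I_{≤n}} E_{q∼A(p)}[‖q − p‖₁] ≥ (1 − δ)/4 · e^{−ε} · ⌊√n⌋. -/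
open scoped ENNReal

/-- `I`: the set of all integer partitions. -/
def IntPart : Type := {p : ℕ → ℕ // IsPartition p}

namespace LowPriv

/-- Staircase of height `m` with corner bits. -/
def stair (m : ℕ) (b : Fin m → Bool) (i : ℕ) : ℕ :=
  if h : i < m then m - 1 - i + (b ⟨i, h⟩).toNat else 0

lemma stair_support (m : ℕ) (b : Fin m → Bool) :
    Function.support (stair m b) ⊆ (Finset.range m : Set ℕ) := by
  intro i hi
  by_contra h
  apply hi
  simp at h
  simp [stair, h]

lemma stair_le (m : ℕ) (b : Fin m → Bool) (i : ℕ) : stair m b i ≤ m := by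
  unfold stair
  split_ifs with h
  · have := Bool.toNat_le (b ⟨i, h⟩)
    omega
  · omega

lemma stair_isPartition (m : ℕ) (b : Fin m → Bool) : IsPartition (stair m b) := by
  refine ⟨antitone_nat_of_succ_le fun i => ?_,
    (Finset.finite_toSet _).subset (stair_support m b)⟩
  unfold stair
  split_ifs with h1 h2
  · have := Bool.toNat_le (b ⟨i + 1, h1⟩)
    omega
  · omega
  · omega
  · omega

lemma stair_psize (n : ℕ) (b : Fin (Nat.sqrt n) → Bool) : psize (stair _ b) ≤ n := by
  unfold psize
  rw [finsum_eq_sum_of_support_subset _ (stair_support _ b)]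
  calc _ ≤ ∑ i ∈ Finset.range (Nat.sqrt n), Nat.sqrt n :=
        Finset.sum_le_sum fun i _ => stair_le _ b i
    _ = Nat.sqrt n * Nat.sqrt n := by simp
    _ ≤ n := Nat.sqrt_le n

/-- The staircase as an input. -/
def P (n : ℕ) (b : Fin (Nat.sqrt n) → Bool) : PartLE n :=
  ⟨stair _ b, stair_isPartition _ b, stair_psize n b⟩

/-- Flip one bit. -/
def bitFlip {m : ℕ} (i : Fin m) (b : Fin m → Bool) : Fin m → Bool :=
  Function.update b i (!b i)

lemma flip_invol {m : ℕ} (i : Fin m) : Function.Involutive (bitFlip i) := by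
  intro b
  simp [bitFlip]

lemma stair_flip_ne {m : ℕ} (i : Fin m) (b : Fin m → Bool) :
    stair m b i ≠ stair m (bitFlip i b) i := by
  simp only [stair, bitFlip, i.2, dite_true, Fin.eta, Function.update_self]
  cases b i <;> simp

lemma l1_flip {m : ℕ} (i : Fin m) (b : Fin m → Bool) :
    l1 (stair m b) (stair m (bitFlip i b)) ≤ 1 := by
  unfold l1
  rw [finsum_eq_single _ (i : ℕ)]
  · simp only [stair, bitFlip, i.2, dite_true, Fin.eta, Function.update_self]
    cases b i <;> simp
  · intro j hj
    unfold stair bitFlip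
    split_ifs with h
    · rw [Function.update_of_ne]
      · simp
      · intro h2
        exact hj (by rw [← h2])
    · simp

lemma l1_ge (m : ℕ) (p q : ℕ → ℕ) (hp : IsPartition p) (hq : IsPartition q) :
    ∑ i : Fin m, (if q i ≠ p i then 1 else 0) ≤ l1 q p := by
  unfold l1
  have hsup : (Function.support fun i => ((q i : ℤ) - (p i : ℤ)).natAbs) ⊆
      ((hq.2.toFinset ∪ hp.2.toFinset ∪ Finset.range m : Finset ℕ) : Set ℕ) := by
    intro i hi
    simp only [Function.mem_support] at hi
    simp only [Finset.coe_union, Set.Finite.coe_toFinset, Set.mem_union, Function.mem_support]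
    left
    omega
  rw [finsum_eq_sum_of_support_subset _ hsup,
    Fin.sum_univ_eq_sum_range (fun i => if q i ≠ p i then 1 else 0) m]
  calc _ ≤ ∑ i ∈ Finset.range m, ((q i : ℤ) - (p i : ℤ)).natAbs := by
        apply Finset.sum_le_sum
        intro i _
        split_ifs with h <;> omega
    _ ≤ _ := Finset.sum_le_sum_of_subset Finset.subset_union_right

lemma err_ge (m : ℕ) (p : ℕ → ℕ) (hp : IsPartition p) (μ : PMF IntPart) :
    ∑ i : Fin m, μ.toOuterMeasure {q | q.1 i ≠ p i} ≤
      ∑' q : IntPart, μ q * (l1 q.1 p : ℝ≥0∞) := by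
  classical
  simp only [PMF.toOuterMeasure_apply]
  rw [← Summable.tsum_finsetSum (fun i _ => ENNReal.summable)]
  refine ENNReal.tsum_le_tsum fun q => ?_
  calc _ = μ q * ((∑ i : Fin m, (if q.1 i ≠ p i then 1 else 0) : ℕ) : ℝ≥0∞) := by
        push_cast
        rw [Finset.mul_sum]
        refine Finset.sum_congr rfl fun i _ => ?_
        simp [Set.indicator_apply]
    _ ≤ _ := by
        gcongr
        exact l1_ge m p q.1 hp q.2

end LowPriv

open LowPriv in
/-- Low-privacy lower bound: for `ε > 0`, `δ ∈ [0, 0.9)`, every `(ε,δ)`-DP algorithm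
`A : I_{≤n} → PMF(I)` has, on some input `p ∈ I_{≤n}`, expected ℓ1-error at least
`(1−δ)/4 · e^{−ε} · ⌊√n⌋`. -/
theorem low_privacy_lower_bound (ε δ : ℝ) (hε : 0 < ε) (hδ0 : 0 ≤ δ) (hδ1 : δ < 0.9)
    (n : ℕ) (A : PartLE n → PMF IntPart)
    (hDP : ∀ p p' : PartLE n, l1 p.1 p'.1 ≤ 1 → ∀ S : Set IntPart,
      (A p).toOuterMeasure S ≤
        ENNReal.ofReal (Real.exp ε) * (A p').toOuterMeasure S + ENNReal.ofReal δ) :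
    ∃ p : PartLE n,
      ENNReal.ofReal ((1 - δ) / 4 * Real.exp (-ε) * (Nat.sqrt n : ℝ)) ≤
        ∑' q : IntPart, A p q * (l1 q.1 p.1 : ℝ≥0∞) := by
  classical
  set m := Nat.sqrt n with hm
  let a : (Fin m → Bool) → Fin m → ℝ≥0∞ := fun b i =>
    (A (P n b)).toOuterMeasure {q | q.1 i ≠ stair m b i}
  have ha1 : ∀ b i, a b i ≤ 1 := fun b i => by
    calc a b i ≤ (A (P n b)).toOuterMeasure Set.univ :=
          MeasureTheory.measure_mono (Set.subset_univ _)
      _ = 1 := ((A (P n b)).toOuterMeasure_apply_eq_one_iff _).2 (Set.subset_univ _)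
  have ha : ∀ b i, a b i ≠ ⊤ := fun b i => ne_top_of_le_ne_top ENNReal.one_ne_top (ha1 b i)
  have key : ∀ b i, 1 ≤ a b i +
      (ENNReal.ofReal (Real.exp ε) * a (bitFlip i b) i + ENNReal.ofReal δ) := fun b i => by
    calc (1 : ℝ≥0∞) = (A (P n b)).toOuterMeasure Set.univ :=
          (((A (P n b)).toOuterMeasure_apply_eq_one_iff _).2 (Set.subset_univ _)).symm
      _ ≤ (A (P n b)).toOuterMeasure ({q | q.1 i ≠ stair m b i} ∪ {q | q.1 i = stair m b i}) :=
          MeasureTheory.measure_mono (fun q _ => by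
            by_cases h : q.1 i = stair m b i
            · exact Or.inr h
            · exact Or.inl h)
      _ ≤ a b i + (A (P n b)).toOuterMeasure {q | q.1 i = stair m b i} :=
          MeasureTheory.measure_union_le _ _
      _ ≤ _ := by
          gcongr
          refine (hDP (P n b) (P n (bitFlip i b)) (l1_flip i b) _).trans ?_
          gcongr
          refine MeasureTheory.measure_mono (fun q hq => ?_)
          have hq' : q.1 i = stair m b i := hq
          show q.1 i ≠ _
          rw [hq']
          exact stair_flip_ne i b
  have keyR : ∀ b i, 1 ≤ (a b i).toReal + (Real.exp ε * (a (bitFlip i b) i).toReal + δ) := by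
    intro b i
    have h := ENNReal.toReal_mono (by finiteness [ha b i, ha (bitFlip i b) i]) (key b i)
    rw [ENNReal.toReal_add (ha b i) (by finiteness [ha (bitFlip i b) i]),
      ENNReal.toReal_add (by finiteness [ha (bitFlip i b) i]) (by finiteness), ENNReal.toReal_mul,
      ENNReal.toReal_ofReal (Real.exp_pos _).le, ENNReal.toReal_ofReal hδ0] at h
    simpa using h
  have sumR : ∀ i, ∑ _b : Fin m → Bool, ((1 - δ) / 4 * Real.exp (-ε)) ≤
      ∑ b, (a b i).toReal := by
    intro i
    have h := Finset.sum_le_sum (s := Finset.univ) (fun b _ => keyR b i)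
    rw [Finset.sum_add_distrib, Finset.sum_add_distrib, ← Finset.mul_sum,
      (flip_invol i).bijective.sum_comp (fun b => (a b i).toReal)] at h
    simp only [Finset.sum_const, nsmul_eq_mul] at h ⊢
    set N : ℝ := ((Finset.univ : Finset (Fin m → Bool)).card : ℝ)
    have hN : 0 ≤ N := Nat.cast_nonneg _
    set s := ∑ b, (a b i).toReal
    have hE : 1 < Real.exp ε := Real.one_lt_exp_iff.2 hε
    have hs : 0 ≤ s := Finset.sum_nonneg fun b _ => ENNReal.toReal_nonneg
    have hd : 0 < 1 - δ := by norm_num at hδ1; linarith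
    rw [Real.exp_neg, ← div_eq_mul_inv, mul_div_assoc', div_le_iff₀ (by linarith)]
    nlinarith [mul_nonneg hN hd.le, mul_nonneg hs (sub_nonneg.2 hE.le)]
  have main : ∑ _b : Fin m → Bool, ENNReal.ofReal ((1 - δ) / 4 * Real.exp (-ε) * (m : ℝ)) ≤
      ∑ b : Fin m → Bool, ∑' q : IntPart, A (P n b) q * (l1 q.1 (P n b).1 : ℝ≥0∞) := by
    refine le_trans ?_ (Finset.sum_le_sum fun b _ =>
      err_ge m (stair m b) (stair_isPartition m b) (A (P n b)))
    have hd : 0 < 1 - δ := by norm_num at hδ1; linarith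
    rw [← ENNReal.ofReal_sum_of_nonneg (fun _ _ => by positivity)]
    refine ENNReal.ofReal_le_of_le_toReal ?_
    rw [ENNReal.toReal_sum (fun b _ => ENNReal.sum_ne_top.2 fun i _ => ha b i)]
    calc _ = ∑ i : Fin m, ∑ _b : Fin m → Bool, ((1 - δ) / 4 * Real.exp (-ε)) := by
          simp only [Finset.sum_const, nsmul_eq_mul, Finset.card_univ, Fintype.card_fin]
          ring
      _ ≤ ∑ i : Fin m, ∑ b, (a b i).toReal := Finset.sum_le_sum fun i _ => sumR i
      _ = ∑ b, ∑ i : Fin m, (a b i).toReal := Finset.sum_comm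
      _ = _ := Finset.sum_congr rfl fun b _ => (ENNReal.toReal_sum fun i _ => ha b i).symm
  by_contra! hcon
  exact absurd main (not_le.2 (ENNReal.sum_lt_sum_of_nonempty Finset.univ_nonempty
    fun b _ => hcon (P n b)))
end

section
/- Let n ∈ ℕ with n ≥ 1, set m = ⌊√n⌋, and for u ∈ {0,1}^m define ψ(u) to be the sequence with ψ(u)_i = 2(m − i) + u_i for 1 ≤ i ≤ m and ψ(u)_i = 0 for i > m. Then for every u ∈ {0,1}^m, ψ(u) is a nonincreasing sequence with finite support whose total sum is at most n (i.e., ψ(u) ∈ I_{≤n}), and for all u, u' ∈ {0,1}^m, ‖ψ(u) − ψ(u')‖₁ = ‖u − u'‖₁ (the Hamming distance between u and u'). -/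
/-- The encoding `ψ(u)_i = 2(m − i) + u_i` for `1 ≤ i ≤ m` and `ψ(u)_i = 0` for `i > m`
(written 0-indexed: `ψ(u)_j = 2(m − 1 − j) + u_j` for `j < m`). -/
def psiLow (m : ℕ) (u : Fin m → Bool) : ℕ → ℕ := fun j =>
  if h : j < m then 2 * (m - 1 - j) + (if u ⟨j, h⟩ then 1 else 0) else 0

theorem psiLow_sum_odd (m : ℕ) : ∑ j ∈ Finset.range m, (2 * (m - 1 - j) + 1) = m * m := by
  rw [Finset.sum_range_reflect (fun j => 2 * j + 1) m]
  induction m with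
  | zero => simp
  | succ k ih => rw [Finset.sum_range_succ, ih]; ring

theorem psiLow_zero (m : ℕ) (u : Fin m → Bool) (j : ℕ) (h : ¬ j < m) : psiLow m u j = 0 := by
  simp [psiLow, h]

theorem psiLow_le (m : ℕ) (u : Fin m → Bool) (j : ℕ) :
    psiLow m u j ≤ 2 * (m - 1 - j) + 1 := by
  unfold psiLow
  split_ifs <;> omega

theorem psiLow_antitone (m : ℕ) (u : Fin m → Bool) : Antitone (psiLow m u) := by
  apply antitone_nat_of_succ_le
  intro j
  unfold psiLow
  split_ifs <;> omega

theorem psiLow_support (m : ℕ) (u : Fin m → Bool) :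
    Function.support (psiLow m u) ⊆ ((Finset.range m : Finset ℕ) : Set ℕ) := by
  intro j hj
  by_contra h
  exact hj (psiLow_zero m u j (by simpa using h))

theorem psiLow_l1 (m : ℕ) (u v : Fin m → Bool) :
    l1 (psiLow m u) (psiLow m v) = hammingDist u v := by
  unfold l1
  rw [finsum_eq_sum_of_support_subset (s := Finset.range m)]
  · rw [← Fin.sum_univ_eq_sum_range
      (fun i => ((psiLow m u i : ℤ) - (psiLow m v i : ℤ)).natAbs)]
    unfold hammingDist
    rw [Finset.card_filter]
    apply Finset.sum_congr rfl
    intro i _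
    simp only [psiLow, i.2, dif_pos, Fin.eta]
    cases u i <;> cases v i <;> simp
  · intro j hj
    by_contra h
    have h' : ¬ j < m := by simpa using h
    apply hj
    simp [psiLow_zero m _ j h']

/-- For `n ≥ 1` and `m = ⌊√n⌋`: every `ψ(u)` is an integer partition of size at most
`n`, and `ψ` preserves distances: `‖ψ(u) − ψ(u')‖₁` equals the Hamming distance
between `u` and `u'`. -/
theorem psiLow_encoding (n : ℕ) (hn : 1 ≤ n) :
    (∀ u : Fin (Nat.sqrt n) → Bool,
      IsPartition (psiLow (Nat.sqrt n) u) ∧ psize (psiLow (Nat.sqrt n) u) ≤ n) ∧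
    (∀ u u' : Fin (Nat.sqrt n) → Bool,
      l1 (psiLow (Nat.sqrt n) u) (psiLow (Nat.sqrt n) u') = hammingDist u u') := by
  refine ⟨fun u => ⟨⟨psiLow_antitone _ u, ?_⟩, ?_⟩, fun u v => psiLow_l1 _ u v⟩
  · exact (Finset.finite_toSet _).subset (psiLow_support _ u)
  · unfold psize
    rw [finsum_eq_sum_of_support_subset _ (psiLow_support _ u)]
    calc _ ≤ ∑ j ∈ Finset.range (Nat.sqrt n), (2 * (Nat.sqrt n - 1 - j) + 1) :=
          Finset.sum_le_sum fun j _ => psiLow_le _ u j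
      _ = Nat.sqrt n * Nat.sqrt n := psiLow_sum_odd _
      _ ≤ n := Nat.sqrt_le n
end

section
/- Let ε > 0, m ∈ ℕ, and let M : ℤ^m → PMF(ℤ^m) be the mechanism that on input u outputs u + (X₁,…,X_m) where X₁,…,X_m are independent with the two-sided geometric distribution Geo(e^{−ε}). Then for all u, u' ∈ ℤ^m and every y ∈ ℤ^m, the probability mass satisfies (M(u))(y) ≤ e^{ε·‖u − u'‖₁} · (M(u'))(y), where ‖u − u'‖₁ = ∑_{i=1}^m |u_i − u'_i|. In particular, M is ε-differentially private: for all u, u' with ‖u − u'‖₁ ≤ 1 and all S ⊆ ℤ^m, Pr_{y∼M(u)}[y ∈ S] ≤ e^ε · Pr_{y∼M(u')}[y ∈ S]. -/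
open scoped ENNReal

/-- The geometric mechanism on `ℤ^m`: if `M u` has probability mass
`(M u)(y) = ∏ i, α^{|y_i − u_i|} · (1−α)/(1+α)` with `α = e^{−ε}` (i.e. `M u` is
`u` plus i.i.d. two-sided `Geo(e^{−ε})` noise in each coordinate), then
`(M u)(y) ≤ e^{ε·‖u−u'‖₁} · (M u')(y)` pointwise; in particular `M` is `ε`-DP. -/
theorem geometric_mechanism_dp (ε : ℝ) (hε : 0 < ε) (m : ℕ)
    (M : (Fin m → ℤ) → PMF (Fin m → ℤ))
    (hM : ∀ u y : Fin m → ℤ,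
      M u y = ENNReal.ofReal
        (∏ i : Fin m, Real.exp (-ε) ^ (y i - u i).natAbs *
          ((1 - Real.exp (-ε)) / (1 + Real.exp (-ε))))) :
    (∀ u u' y : Fin m → ℤ,
      M u y ≤
        ENNReal.ofReal (Real.exp (ε * ∑ i : Fin m, ((u i - u' i).natAbs : ℝ))) *
          M u' y) ∧
    (∀ u u' : Fin m → ℤ, (∑ i : Fin m, (u i - u' i).natAbs) ≤ 1 →
      ∀ S : Set (Fin m → ℤ),
        (M u).toOuterMeasure S ≤
          ENNReal.ofReal (Real.exp ε) * (M u').toOuterMeasure S) := by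
  have key : ∀ u u' y : Fin m → ℤ,
      M u y ≤
        ENNReal.ofReal (Real.exp (ε * ∑ i : Fin m, ((u i - u' i).natAbs : ℝ))) *
          M u' y := by
    intro u u' y
    have h1 : Real.exp (-ε) < 1 := by
      rw [Real.exp_lt_one_iff]
      linarith
    have hc : 0 ≤ (1 - Real.exp (-ε)) / (1 + Real.exp (-ε)) :=
      div_nonneg (by linarith) (by positivity)
    rw [hM, hM, ← ENNReal.ofReal_mul (Real.exp_pos _).le]
    apply ENNReal.ofReal_le_ofReal
    rw [Finset.mul_sum, Real.exp_sum, ← Finset.prod_mul_distrib]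
    apply Finset.prod_le_prod
    · intro i _
      exact mul_nonneg (by positivity) hc
    · intro i _
      rw [← mul_assoc]
      apply mul_le_mul_of_nonneg_right _ hc
      rw [← Real.exp_nat_mul, ← Real.exp_nat_mul, ← Real.exp_add]
      apply Real.exp_le_exp.mpr
      have h2 : (y i - u' i).natAbs ≤ (u i - u' i).natAbs + (y i - u i).natAbs := by omega
      have h3 : ((y i - u' i).natAbs : ℝ) ≤ (u i - u' i).natAbs + (y i - u i).natAbs := by
        exact_mod_cast h2
      nlinarith
  refine ⟨key, ?_⟩
  intro u u' h S
  rw [PMF.toOuterMeasure_apply, PMF.toOuterMeasure_apply, ← ENNReal.tsum_mul_left]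
  apply ENNReal.tsum_le_tsum
  intro y
  by_cases hy : y ∈ S
  · simp only [Set.indicator_of_mem hy]
    refine (key u u' y).trans ?_
    gcongr
    have h4 : ∑ i : Fin m, ((u i - u' i).natAbs : ℝ) ≤ 1 := by exact_mod_cast h
    nlinarith
  · simp [Set.indicator_of_notMem hy]
end

section
/- Let n, Δ ∈ ℕ with n ≥ Δ and Δ > 10·√n. Set L = ⌊(1/2)·log₂(Δ/√n)⌋, R = ⌊n/Δ⌋, and m = R·L. For ℓ ∈ {1,…,L} set s^ℓ = ⌊Δ/(L·2^ℓ)⌋, d^ℓ = ⌊s^ℓ/R⌋, and p^ℓ_r = s^ℓ + (R − r)·d^ℓ for r ∈ {0,1,…,R}. For v ∈ {0,1}^R define ψ^ℓ(v) ∈ ℕ^R by ψ^ℓ(v)_r = p^ℓ_r if v_r = 0 and ψ^ℓ(v)_r = p^ℓ_{r−1} if v_r = 1. For z ∈ {0,1}^{RL}, writing z as consecutive blocks z¹,…,z^L ∈ {0,1}^R, define ψ(z) to be the finite sequence obtained by concatenating, for ℓ = 1,…,L in order, the vector ψ^ℓ(z^ℓ) with each of its entries repeated 2^{ℓ−1}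 times consecutively, followed by zeros. Then: (i) for every z, ψ(z) is nonincreasing and ∑_i ψ(z)_i ≤ n (so ψ(z) ∈ I_{≤n}); and (ii) for all y, z ∈ {0,1}^{RL}, ‖ψ(y) − ψ(z)‖₁ = ∑_{ℓ=1}^{L} 2^{ℓ−1} · d^ℓ · |{r ∈ {1,…,R} : (y^ℓ)_r ≠ (z^ℓ)_r}|. -/
/-- `L = ⌊(1/2)·log₂(Δ/√n)⌋`. -/
noncomputable def Lval (n Δ : ℕ) : ℕ :=
  ⌊(1 / 2 : ℝ) * Real.logb 2 ((Δ : ℝ) / Real.sqrt n)⌋₊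

/-- `R = ⌊n/Δ⌋`. -/
def Rval (n Δ : ℕ) : ℕ := n / Δ

/-- `s^ℓ = ⌊Δ/(L·2^ℓ)⌋`. -/
noncomputable def sval (n Δ ℓ : ℕ) : ℕ := Δ / (Lval n Δ * 2 ^ ℓ)

/-- `d^ℓ = ⌊s^ℓ/R⌋`. -/
noncomputable def dval (n Δ ℓ : ℕ) : ℕ := sval n Δ ℓ / Rval n Δ

/-- `p^ℓ_r = s^ℓ + (R − r)·d^ℓ` for `r ∈ {0, 1, …, R}`. -/
noncomputable def pval (n Δ ℓ r : ℕ) : ℕ :=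
  sval n Δ ℓ + (Rval n Δ - r) * dval n Δ ℓ

/-- The finite list `ψ(z)`: for `ℓ = 1, …, L` in order, the block
`ψ^ℓ(z^ℓ) = (p^ℓ_r if (z^ℓ)_r = 0, p^ℓ_{r−1} if (z^ℓ)_r = 1)_{r = 1, …, R}`,
with each entry repeated `2^{ℓ−1}` times consecutively.  Here `z^ℓ` is the `ℓ`-th
consecutive block of `R` coordinates of `z`, i.e. `(z^ℓ)_r = z (R·(ℓ−1) + (r−1))`
(0-indexed coordinates of `z : ℕ → Bool`). -/
noncomputable def psiList (n Δ : ℕ) (z : ℕ → Bool) : List ℕ :=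
  (List.range (Lval n Δ)).flatMap fun ℓ' =>
    (List.range (Rval n Δ)).flatMap fun r' =>
      List.replicate (2 ^ ℓ')
        (if z (Rval n Δ * ℓ' + r') then pval n Δ (ℓ' + 1) r'
         else pval n Δ (ℓ' + 1) (r' + 1))

/-- `ψ(z)` as a sequence: the list `psiList` followed by zeros. -/
noncomputable def psiSeq (n Δ : ℕ) (z : ℕ → Bool) : ℕ → ℕ :=
  fun i => (psiList n Δ z).getD i 0

theorem aux_finsum_getD (l : List ℕ) : ∑ᶠ i : ℕ, l.getD i 0 = l.sum := by
  have hs : Function.support (fun i => l.getD i 0) ⊆ (Finset.range l.length : Set ℕ) := by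
    intro i hi
    by_contra hc
    simp only [Finset.coe_range, Set.mem_Iio, not_lt] at hc
    exact hi (List.getD_eq_default l 0 hc)
  rw [finsum_eq_sum_of_support_subset _ hs]
  clear hs
  induction l with
  | nil => simp
  | cons a t ih =>
    rw [List.length_cons, Finset.sum_range_succ', List.sum_cons]
    simp only [List.getD_cons_succ, List.getD_cons_zero]
    rw [ih, add_comm]

theorem aux_zip_getD (f : ℕ → ℕ → ℕ) (hf : f 0 0 = 0) (a b : List ℕ)
    (h : a.length = b.length) (i : ℕ) :
    (List.zipWith f a b).getD i 0 = f (a.getD i 0) (b.getD i 0) := by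
  by_cases hi : i < a.length
  · have hb : i < b.length := h ▸ hi
    simp [List.getD_eq_getElem?_getD, hi, hb]
  · have hb : ¬ i < b.length := h ▸ hi
    rw [List.getD_eq_default _ _ (not_lt.mp hi), List.getD_eq_default _ _ (not_lt.mp hb),
      List.getD_eq_default _ _ (by simp; omega), hf]

theorem aux_sum_range (f : ℕ → ℕ) (k : ℕ) :
    ((List.range k).map f).sum = ∑ i ∈ Finset.range k, f i := by
  induction k with
  | zero => simp
  | succ k ih => simp [List.range_succ, Finset.sum_range_succ, ih]

theorem aux_len_flatMap (a b : ℕ → List ℕ) (h : ∀ x, (a x).length = (b x).length)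
    (l : List ℕ) : (l.flatMap a).length = (l.flatMap b).length := by
  simp [List.length_flatMap, h]

theorem aux_zip_flatMap (f : ℕ → ℕ → ℕ) (a b : ℕ → List ℕ)
    (h : ∀ x, (a x).length = (b x).length) (l : List ℕ) :
    (List.zipWith f (l.flatMap a) (l.flatMap b)).sum =
      (l.map fun x => (List.zipWith f (a x) (b x)).sum).sum := by
  induction l with
  | nil => simp
  | cons x t ih =>
    rw [List.flatMap_cons, List.flatMap_cons, List.zipWith_append (h x), List.sum_append, ih,
      List.map_cons, List.sum_cons]

theorem aux_sum_flatMap (a : ℕ → List ℕ) (l : List ℕ) :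
    (l.flatMap a).sum = (l.map fun x => (a x).sum).sum := by
  induction l with
  | nil => simp
  | cons x t ih => simp [ih]

theorem aux_pval_anti (n Δ ℓ : ℕ) {r r' : ℕ} (h : r ≤ r') :
    pval n Δ ℓ r' ≤ pval n Δ ℓ r := by
  unfold pval
  gcongr

theorem aux_pval_lower (n Δ ℓ r : ℕ) : sval n Δ ℓ ≤ pval n Δ ℓ r := by
  unfold pval; omega

theorem aux_pval_upper (n Δ ℓ r : ℕ) : pval n Δ ℓ r ≤ 2 * sval n Δ ℓ := by
  have h1 : (Rval n Δ - r) * dval n Δ ℓ ≤ Rval n Δ * dval n Δ ℓ := by gcongr; omega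
  have h2 : Rval n Δ * dval n Δ ℓ ≤ sval n Δ ℓ := Nat.mul_div_le _ _
  unfold pval
  omega

theorem aux_sval_step (n Δ : ℕ) {ℓ ℓ' : ℕ} (h : ℓ < ℓ') :
    2 * sval n Δ ℓ' ≤ sval n Δ ℓ := by
  unfold sval
  obtain ⟨k, rfl⟩ := Nat.exists_eq_add_of_lt h
  have : Lval n Δ * 2 ^ (ℓ + k + 1) = Lval n Δ * 2 ^ ℓ * (2 ^ k * 2) := by ring
  rw [this, ← Nat.div_div_eq_div_mul, ← Nat.div_div_eq_div_mul]
  calc _ ≤ (Δ / (Lval n Δ * 2 ^ ℓ)) / 2 ^ k := Nat.mul_div_le _ _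
    _ ≤ _ := Nat.div_le_self _ _

theorem aux_sval_sum (n Δ ℓ : ℕ) : 2 ^ ℓ * sval n Δ ℓ ≤ Δ / Lval n Δ := by
  unfold sval
  rw [← Nat.div_div_eq_div_mul]
  exact Nat.mul_div_le _ _

theorem aux_sorted (n Δ : ℕ) (z : ℕ → Bool) : (psiList n Δ z).Pairwise (· ≥ ·) := by
  unfold psiList
  rw [List.pairwise_flatMap]
  refine ⟨fun ℓ _ => ?_, ?_⟩
  · rw [List.pairwise_flatMap]
    refine ⟨fun r _ => by simp [List.pairwise_replicate], ?_⟩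
    refine List.pairwise_lt_range.imp ?_
    intro r r' h x hx y hy
    rw [List.eq_of_mem_replicate hx, List.eq_of_mem_replicate hy]
    split_ifs <;> exact aux_pval_anti _ _ _ (by omega)
  · refine List.pairwise_lt_range.imp ?_
    intro ℓ ℓ' h x hx y hy
    obtain ⟨r, -, hx⟩ := List.mem_flatMap.mp hx
    obtain ⟨r', -, hy⟩ := List.mem_flatMap.mp hy
    rw [List.eq_of_mem_replicate hx, List.eq_of_mem_replicate hy]
    have hs := aux_sval_step n Δ (Nat.succ_lt_succ h)
    split_ifs <;> exact (aux_pval_upper _ _ _ _).trans (hs.trans (aux_pval_lower _ _ _ _))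

theorem aux_antitone (l : List ℕ) (h : l.Pairwise (· ≥ ·)) :
    Antitone (fun i => l.getD i 0) := by
  intro i j hij
  rcases hij.eq_or_lt with rfl | hij
  · exact le_rfl
  by_cases hj : j < l.length
  · have hi : i < l.length := hij.trans hj
    simp only [List.getD_eq_getElem _ _ hi, List.getD_eq_getElem _ _ hj]
    exact List.pairwise_iff_getElem.mp h i j hi hj hij
  · simp only [List.getD_eq_default _ _ (not_lt.mp hj)]
    exact Nat.zero_le _

theorem aux_sum_le (n Δ : ℕ) (z : ℕ → Bool) : (psiList n Δ z).sum ≤ n := by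
  unfold psiList
  rw [aux_sum_flatMap, aux_sum_range]
  have hb : ∀ ℓ ∈ Finset.range (Lval n Δ), ((List.range (Rval n Δ)).flatMap fun r' =>
      List.replicate (2 ^ ℓ)
        (if z (Rval n Δ * ℓ + r') then pval n Δ (ℓ + 1) r'
         else pval n Δ (ℓ + 1) (r' + 1))).sum ≤ Rval n Δ * (Δ / Lval n Δ) := by
    intro ℓ _
    rw [aux_sum_flatMap, aux_sum_range]
    refine (Finset.sum_le_card_nsmul _ _ (Δ / Lval n Δ) ?_).trans (by simp)
    intro r _
    rw [List.sum_replicate, smul_eq_mul]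
    refine le_trans ?_ (aux_sval_sum n Δ (ℓ + 1))
    rw [pow_succ, mul_assoc]
    gcongr
    split_ifs <;> exact aux_pval_upper _ _ _ _
  refine (Finset.sum_le_card_nsmul _ _ _ hb).trans ?_
  rw [Finset.card_range, smul_eq_mul]
  calc Lval n Δ * (Rval n Δ * (Δ / Lval n Δ))
      = Rval n Δ * (Lval n Δ * (Δ / Lval n Δ)) := by ring
    _ ≤ Rval n Δ * Δ := by gcongr; exact Nat.mul_div_le _ _
    _ ≤ n := Nat.div_mul_le_self _ _

theorem aux_pval_diff (n Δ ℓ r : ℕ) (hr : r < Rval n Δ) :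
    pval n Δ ℓ r = pval n Δ ℓ (r + 1) + dval n Δ ℓ := by
  unfold pval
  obtain ⟨k, hk⟩ := Nat.exists_eq_add_of_lt hr
  have e1 : Rval n Δ - r = k + 1 := by omega
  have e2 : Rval n Δ - (r + 1) = k := by omega
  rw [e1, e2]; ring

theorem aux_l1 (n Δ : ℕ) (y z : ℕ → Bool) :
      l1 (psiSeq n Δ y) (psiSeq n Δ z) =
        ∑ ℓ' ∈ Finset.range (Lval n Δ),
          2 ^ ℓ' * dval n Δ (ℓ' + 1) *
            ((Finset.range (Rval n Δ)).filter fun r' =>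
              y (Rval n Δ * ℓ' + r') ≠ z (Rval n Δ * ℓ' + r')).card := by
  have hlen : (psiList n Δ y).length = (psiList n Δ z).length := by
    unfold psiList
    refine aux_len_flatMap _ _ (fun ℓ => aux_len_flatMap _ _ (fun r => ?_) _) _
    simp
  have key := aux_zip_getD (fun a b => ((a : ℤ) - (b : ℤ)).natAbs) (by simp) _ _ hlen
  unfold l1 psiSeq
  simp only [← key]
  rw [aux_finsum_getD]
  unfold psiList
  rw [aux_zip_flatMap _ _ _ (fun ℓ => aux_len_flatMap _ _ (fun r => by simp) _), aux_sum_range]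
  refine Finset.sum_congr rfl fun ℓ _ => ?_
  rw [aux_zip_flatMap _ _ _ (fun r => by simp), aux_sum_range, Finset.card_filter,
    Finset.mul_sum]
  refine Finset.sum_congr rfl fun r hr => ?_
  rw [List.zipWith_replicate', List.sum_replicate, smul_eq_mul, mul_assoc]
  congr 1
  rw [aux_pval_diff n Δ (ℓ + 1) r (Finset.mem_range.mp hr)]
  cases y (Rval n Δ * ℓ + r) <;> cases z (Rval n Δ * ℓ + r) <;> simp

/-- For `n ≥ Δ > 10·√n`: (i) every `ψ(z)` is a nonincreasing sequence of total sum at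
most `n` (so `ψ(z) ∈ I_{≤n}`); (ii) for all boolean vectors `y, z`,
`‖ψ(y) − ψ(z)‖₁ = ∑_{ℓ=1}^{L} 2^{ℓ−1}·d^ℓ·|{r ∈ {1,…,R} : (y^ℓ)_r ≠ (z^ℓ)_r}|`. -/
theorem psi_encoding (n Δ : ℕ) (h1 : Δ ≤ n) (h2 : 10 * Real.sqrt n < (Δ : ℝ)) :
    (∀ z : ℕ → Bool, IsPartition (psiSeq n Δ z) ∧ psize (psiSeq n Δ z) ≤ n) ∧
    (∀ y z : ℕ → Bool,
      l1 (psiSeq n Δ y) (psiSeq n Δ z) =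
        ∑ ℓ' ∈ Finset.range (Lval n Δ),
          2 ^ ℓ' * dval n Δ (ℓ' + 1) *
            ((Finset.range (Rval n Δ)).filter fun r' =>
              y (Rval n Δ * ℓ' + r') ≠ z (Rval n Δ * ℓ' + r')).card) := by
  exact ⟨fun z => ⟨⟨aux_antitone _ (aux_sorted n Δ z), by
      refine (Finset.range (psiList n Δ z).length).finite_toSet.subset ?_
      intro i hi
      by_contra hc
      simp only [Finset.coe_range, Set.mem_Iio, not_lt] at hc
      exact hi (List.getD_eq_default _ 0 hc)⟩,
    (aux_finsum_getD _).trans_le (aux_sum_le n Δ z)⟩, aux_l1 n Δ⟩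
end
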